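/- For every natural number n there exists a complete and consistent extension T of Robinson arithmetic Q such that T + Πₙ-Th(ℕ) is consistent (equivalently, T contains Πₙ-Th(ℕ) and is n-consistent) and the set of (Gödel numbers of) axioms of T is definable in ℕ by a Π_{n+1}-formula. In particular, Rosser's incompleteness theorem fails for Π_{n+1}-definable theories. -/

import Mathlib

/-!
Formalization of results from "Gödel–Rosser's Incompleteness Theorems for
non-RE Theories" (Salehi & Seraji).

We work in the first-order language of arithmetic `{0, S, +, ×, ≤}` with the
standard model `ℕ`.  Provability `T ⊢ φ` is rendered as the semantic
consequence `T ⊨ᵇ φ` of Mathlib's model theory library, which by the Gödel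
completeness theorem coincides with provability in first-order logic.
-/

open FirstOrder Language BoundedFormula

namespace GRNonRE

/-- Function symbols of arithmetic: `0`, `S`, `+`, `×`. -/
inductive ArithFunc : ℕ → Type
  | zero : ArithFunc 0
  | succ : ArithFunc 1
  | add  : ArithFunc 2
  | mul  : ArithFunc 2

/-- The relation symbol `≤`. -/
inductive ArithRel : ℕ → Type
  | le : ArithRel 2

/-- The first-order language of arithmetic `{0, S, +, ×, ≤}`. -/
def LA : FirstOrder.Language := ⟨ArithFunc, ArithRel⟩

/-- The standard model `ℕ`. -/
instance : LA.Structure ℕ where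
  funMap {_} f := match f with
    | ArithFunc.zero => fun _ => 0
    | ArithFunc.succ => fun v => v 0 + 1
    | ArithFunc.add  => fun v => v 0 + v 1
    | ArithFunc.mul  => fun v => v 0 * v 1
  RelMap {_} r := match r with
    | ArithRel.le => fun v => v 0 ≤ v 1

def zeroT {α : Type} : LA.Term α := Term.func ArithFunc.zero ![]
def succT {α : Type} (t : LA.Term α) : LA.Term α := Term.func ArithFunc.succ ![t]
def addT {α : Type} (t s : LA.Term α) : LA.Term α := Term.func ArithFunc.add ![t, s]
def mulT {α : Type} (t s : LA.Term α) : LA.Term α := Term.func ArithFunc.mul ![t, s]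

/-- The atomic formula `t ≤ s`. -/
def leF {α : Type} {n : ℕ} (t s : LA.Term (α ⊕ Fin n)) : LA.BoundedFormula α n :=
  BoundedFormula.rel ArithRel.le ![t, s]

/-- The numeral `m̄ = S (S ⋯ (S 0))` representing `m : ℕ`. -/
def numeral : ℕ → LA.Term Empty
  | 0 => zeroT
  | n + 1 => succT (numeral n)

instance : Encodable (Σ n, LA.Functions n) :=
  ⟨fun f => match f with
    | ⟨_, ArithFunc.zero⟩ => 0
    | ⟨_, ArithFunc.succ⟩ => 1
    | ⟨_, ArithFunc.add⟩ => 2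
    | ⟨_, ArithFunc.mul⟩ => 3,
   fun n => match n with
    | 0 => some ⟨0, ArithFunc.zero⟩
    | 1 => some ⟨1, ArithFunc.succ⟩
    | 2 => some ⟨2, ArithFunc.add⟩
    | 3 => some ⟨2, ArithFunc.mul⟩
    | _ => none,
   by rintro ⟨n, f⟩; cases f <;> rfl⟩

instance : Encodable (Σ n, LA.Relations n) :=
  ⟨fun _ => 0,
   fun n => match n with
    | 0 => some ⟨2, ArithRel.le⟩
    | _ => none,
   by rintro ⟨n, r⟩; cases r; rfl⟩

/-- A standard Gödel numbering of formulas, obtained from Mathlib's structural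
encoding of bounded formulas as lists of symbols. -/
def godel {k : ℕ} (φ : LA.BoundedFormula Empty k) : ℕ :=
  Encodable.encode φ.listEncode

/-- Lift a term in context `k` to context `k + 1`. -/
def liftT {k : ℕ} (t : LA.Term (Empty ⊕ Fin k)) : LA.Term (Empty ⊕ Fin (k + 1)) :=
  t.relabel (Sum.map id Fin.castSucc)

/-- The class `Σ₀ = Π₀ = Δ₀` of bounded formulas: built from atomic formulas by
Boolean connectives (`⊥` and `⟹`, from which `∼`, `⊓`, `⊔` are definable) and
bounded universal quantification `∀ x ≤ t, φ` (bounded existential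
quantification `∃ x ≤ t, φ` is expressible as `∼ ∀ x ≤ t, ∼φ`). -/
inductive Delta0 : ∀ {k : ℕ}, LA.BoundedFormula Empty k → Prop
  | falsum {k : ℕ} : Delta0 (⊥ : LA.BoundedFormula Empty k)
  | equal {k : ℕ} (t₁ t₂ : LA.Term (Empty ⊕ Fin k)) : Delta0 (t₁ =' t₂)
  | le {k : ℕ} (t₁ t₂ : LA.Term (Empty ⊕ Fin k)) : Delta0 (leF t₁ t₂)
  | imp {k : ℕ} {φ ψ : LA.BoundedFormula Empty k} :
      Delta0 φ → Delta0 ψ → Delta0 (φ ⟹ ψ)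
  | bdall {k : ℕ} (t : LA.Term (Empty ⊕ Fin k)) {φ : LA.BoundedFormula Empty (k + 1)} :
      Delta0 φ → Delta0 ((leF (&(Fin.last k)) (liftT t) ⟹ φ).all)

mutual
  /-- The classes `Σₙ` of the arithmetical hierarchy: `Σ₀` is the class of
  bounded formulas, and `Σ_{n+1}` contains `Πₙ` and is closed under `⊓`, `⊔`,
  existential quantification and bounded universal quantification. -/
  inductive IsSigma : ℕ → ∀ {k : ℕ}, LA.BoundedFormula Empty k → Prop
    | ofDelta0 {k : ℕ} {φ : LA.BoundedFormula Empty k} : Delta0 φ → IsSigma 0 φ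
    | ofPi {n k : ℕ} {φ : LA.BoundedFormula Empty k} :
        IsPi n φ → IsSigma (n + 1) φ
    | ex {n k : ℕ} {φ : LA.BoundedFormula Empty (k + 1)} :
        IsSigma (n + 1) φ → IsSigma (n + 1) φ.ex
    | inf {n k : ℕ} {φ ψ : LA.BoundedFormula Empty k} :
        IsSigma (n + 1) φ → IsSigma (n + 1) ψ → IsSigma (n + 1) (φ ⊓ ψ)
    | sup {n k : ℕ} {φ ψ : LA.BoundedFormula Empty k} :
        IsSigma (n + 1) φ → IsSigma (n + 1) ψ → IsSigma (n + 1) (φ ⊔ ψ)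
    | bdall {n k : ℕ} (t : LA.Term (Empty ⊕ Fin k))
        {φ : LA.BoundedFormula Empty (k + 1)} :
        IsSigma (n + 1) φ → IsSigma (n + 1) ((leF (&(Fin.last k)) (liftT t) ⟹ φ).all)

  /-- The classes `Πₙ` of the arithmetical hierarchy: `Π₀` is the class of
  bounded formulas, and `Π_{n+1}` contains `Σₙ` and is closed under `⊓`, `⊔`,
  universal quantification and bounded existential quantification. -/
  inductive IsPi : ℕ → ∀ {k : ℕ}, LA.BoundedFormula Empty k → Prop
    | ofDelta0 {k : ℕ} {φ : LA.BoundedFormula Empty k} : Delta0 φ → IsPi 0 φ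
    | ofSigma {n k : ℕ} {φ : LA.BoundedFormula Empty k} :
        IsSigma n φ → IsPi (n + 1) φ
    | all {n k : ℕ} {φ : LA.BoundedFormula Empty (k + 1)} :
        IsPi (n + 1) φ → IsPi (n + 1) φ.all
    | inf {n k : ℕ} {φ ψ : LA.BoundedFormula Empty k} :
        IsPi (n + 1) φ → IsPi (n + 1) ψ → IsPi (n + 1) (φ ⊓ ψ)
    | sup {n k : ℕ} {φ ψ : LA.BoundedFormula Empty k} :
        IsPi (n + 1) φ → IsPi (n + 1) ψ → IsPi (n + 1) (φ ⊔ ψ)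
    | bdex {n k : ℕ} (t : LA.Term (Empty ⊕ Fin k))
        {φ : LA.BoundedFormula Empty (k + 1)} :
        IsPi (n + 1) φ → IsPi (n + 1) ((leF (&(Fin.last k)) (liftT t) ⊓ φ).ex)
end

/-- `T ⊢ φ`: by the Gödel completeness theorem, provability of the sentence `φ`
from the theory `T` coincides with the semantic consequence relation. -/
def Proves (T : LA.Theory) (φ : LA.Sentence) : Prop := T ⊨ᵇ φ

/-- Consistency of a theory. -/
def Consistent (T : LA.Theory) : Prop := ¬ Proves T ⊥

/-- `ψ(m̄)`: the result of substituting the numeral `m̄` for the free variable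
of a formula `ψ(x)` with one free variable. -/
def subst1 (ψ : LA.BoundedFormula Empty 1) (m : ℕ) : LA.Sentence :=
  ψ.toFormula.subst fun _ => numeral m

/-- `n`-consistency: there is no formula `ψ(x) ∈ Π_{n-1}` such that `T ⊢ ¬ψ(m̄)`
for every numeral `m̄` (`m ∈ ℕ`) and yet `T ⊢ ∃x ψ(x)`.
(`0`-consistency is ordinary consistency.) -/
def NCon : ℕ → LA.Theory → Prop
  | 0, T => Consistent T
  | n + 1, T => ¬ ∃ ψ : LA.BoundedFormula Empty 1, IsPi n ψ ∧
      (∀ m : ℕ, Proves T (∼(subst1 ψ m))) ∧ Proves T ψ.ex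

/-- The axioms of Robinson arithmetic `Q`:
`Sx ≠ 0`, `Sx = Sy → x = y`, `x ≠ 0 → ∃y x = Sy`, `x + 0 = x`,
`x + Sy = S(x + y)`, `x·0 = 0`, `x·Sy = x·y + x`, `x ≤ y ↔ ∃z z + x = y`. -/
def QTheory : LA.Theory :=
  { ∀' ∼(succT (&0) =' zeroT),
    ∀' ∀' ((succT (&0) =' succT (&1)) ⟹ (&0 =' &1)),
    ∀' (∼(&0 =' zeroT) ⟹ ∃' (&0 =' succT (&1))),
    ∀' (addT (&0) zeroT =' &0),
    ∀' ∀' (addT (&0) (succT (&1)) =' succT (addT (&0) (&1))),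
    ∀' (mulT (&0) zeroT =' zeroT),
    ∀' ∀' (mulT (&0) (succT (&1)) =' addT (mulT (&0) (&1)) (&0)),
    ((leF (&0) (&1) ⇔ ∃' (addT (&2) (&0) =' (&1)) : LA.BoundedFormula Empty 2)).alls }

/-- `T` is an extension of Robinson arithmetic `Q` (i.e. `T` proves `Q`). -/
def ExtendsQ (T : LA.Theory) : Prop := ∀ φ ∈ QTheory, Proves T φ

/-- `Πₙ-Th(ℕ)`: the set of `Πₙ`-sentences true in the standard model. -/
def PiTh (n : ℕ) : LA.Theory := {φ | IsPi n φ ∧ ℕ ⊨ φ}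

/-- Soundness: every theorem of `T` is true in `ℕ`. -/
def Sound (T : LA.Theory) : Prop := ∀ φ : LA.Sentence, Proves T φ → ℕ ⊨ φ

/-- `Σₙ`-soundness: every `Σₙ`-sentence provable in `T` is true in `ℕ`. -/
def SigmaSound (n : ℕ) (T : LA.Theory) : Prop :=
  ∀ φ : LA.Sentence, IsSigma n φ → Proves T φ → ℕ ⊨ φ

/-- A formula `Ψ(x)` with one free variable defines the set `A ⊆ ℕ` in `ℕ`. -/
def Defines (Ψ : LA.BoundedFormula Empty 1) (A : Set ℕ) : Prop :=
  ∀ m : ℕ, m ∈ A ↔ Ψ.Realize (fun e => Empty.elim e) ![m]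

/-- `A ⊆ ℕ` is definable in `ℕ` by a `Σₙ`-formula. -/
def SigmaDefinable (n : ℕ) (A : Set ℕ) : Prop := ∃ Ψ, IsSigma n Ψ ∧ Defines Ψ A

/-- `A ⊆ ℕ` is definable in `ℕ` by a `Πₙ`-formula. -/
def PiDefinable (n : ℕ) (A : Set ℕ) : Prop := ∃ Ψ, IsPi n Ψ ∧ Defines Ψ A

/-- The set of Gödel numbers of the axioms of `T`. -/
def axiomCodes (T : LA.Theory) : Set ℕ := {m | ∃ φ ∈ T, godel φ = m}

/-- The set of Gödel numbers of the theorems of `T` (its deductive closure). -/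
def theoremCodes (T : LA.Theory) : Set ℕ := {m | ∃ φ, Proves T φ ∧ godel φ = m}

/-! ### Primitive recursive building blocks -/

section Primrec

attribute [fun_prop] Primrec Primrec.id Primrec.const Primrec.comp Primrec.pair Primrec.fst
  Primrec.snd Primrec.encode

variable {α : Type} [Primcodable α]

@[fun_prop]
theorem primrec_natPair {f g : α → ℕ} (hf : Primrec f) (hg : Primrec g) :
    Primrec fun a => Nat.pair (f a) (g a) := Primrec₂.natPair.comp hf hg

@[fun_prop]
theorem primrec_unpair {f : α → ℕ} (hf : Primrec f) : Primrec fun a => Nat.unpair (f a) :=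
  Primrec.unpair.comp hf

@[fun_prop]
theorem primrec_add {f g : α → ℕ} (hf : Primrec f) (hg : Primrec g) :
    Primrec fun a => f a + g a := Primrec.nat_add.comp hf hg

@[fun_prop]
theorem primrec_mul {f g : α → ℕ} (hf : Primrec f) (hg : Primrec g) :
    Primrec fun a => f a * g a := Primrec.nat_mul.comp hf hg

@[fun_prop]
theorem primrec_div {f g : α → ℕ} (hf : Primrec f) (hg : Primrec g) :
    Primrec fun a => f a / g a := Primrec.nat_div.comp hf hg

@[fun_prop]
theorem primrec_mod {f g : α → ℕ} (hf : Primrec f) (hg : Primrec g) :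
    Primrec fun a => f a % g a := Primrec.nat_mod.comp hf hg

@[fun_prop]
theorem primrec_max {f g : α → ℕ} (hf : Primrec f) (hg : Primrec g) :
    Primrec fun a => max (f a) (g a) := Primrec.nat_max.comp hf hg

@[fun_prop]
theorem primrec_pow {f g : α → ℕ} (hf : Primrec f) (hg : Primrec g) :
    Primrec fun a => f a ^ g a := (Primrec₂.unpaired'.1 Nat.Primrec.pow).comp hf hg

@[fun_prop]
theorem primrec_cons {β : Type} [Primcodable β] {f : α → β} {g : α → List β} (hf : Primrec f)
    (hg : Primrec g) : Primrec fun a => f a :: g a := Primrec.list_cons.comp hf hg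

@[fun_prop]
theorem primrec_append {β : Type} [Primcodable β] {f g : α → List β} (hf : Primrec f)
    (hg : Primrec g) : Primrec fun a => f a ++ g a := Primrec.list_append.comp hf hg

@[fun_prop]
theorem primrec_getD {f : α → List ℕ} {g : α → ℕ} (d : ℕ) (hf : Primrec f)
    (hg : Primrec g) : Primrec fun a => (f a).getD (g a) d := (Primrec.list_getD d).comp hf hg

/-- Decode a number as a list of numbers. -/
def listOf (n : ℕ) : List ℕ := (Encodable.decode n).getD []

@[simp] theorem listOf_encode (v : List ℕ) : listOf (Encodable.encode v) = v := by simp [listOf]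

@[simp] theorem encode_listOf (n : ℕ) : Encodable.encode (listOf n) = n := by
  rw [listOf, Denumerable.decode_eq_ofNat (List ℕ) n]
  simp

@[fun_prop]
theorem primrec_listOf {f : α → ℕ} (hf : Primrec f) : Primrec fun a => listOf (f a) :=
  Primrec.option_getD.comp (Primrec.decode.comp hf) (Primrec.const [])

theorem primrecPred_eq {β : Type} [Primcodable β] {f g : α → β} (hf : Primrec f)
    (hg : Primrec g) : PrimrecPred fun a => f a = g a := Primrec.eq.comp hf hg

theorem primrecPred_le {f g : α → ℕ} (hf : Primrec f) (hg : Primrec g) :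
    PrimrecPred fun a => f a ≤ g a := Primrec.nat_le.comp hf hg

end Primrec

/-! ### The arithmetical hierarchy over primitive recursive predicates -/

/-- `Sig n` is the class of predicates defined by `n` alternating unbounded number quantifiers
(the first one existential) in front of a primitive recursive matrix. -/
def Sig : ℕ → ∀ {α : Type} [Primcodable α], (α → Prop) → Prop
  | 0, _, _, A => PrimrecPred A
  | n + 1, α, _, A => ∃ B : α × ℕ → Prop, Sig n B ∧ ∀ a, A a ↔ ∃ y, ¬ B (a, y)

namespace Sig

variable {α β : Type} [Primcodable α] [Primcodable β]

theorem of_iff {n : ℕ} {A B : α → Prop} (hA : Sig n A) (h : ∀ a, B a ↔ A a) : Sig n B := by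
  have : B = A := funext fun a => propext (h a)
  rwa [this]

theorem comp {n : ℕ} {A : β → Prop} (hA : Sig n A) {f : α → β} (hf : Primrec f) :
    Sig n fun a => A (f a) := by
  induction n generalizing α β with
  | zero => exact PrimrecPred.comp hA hf
  | succ n ih =>
    obtain ⟨B, hB, h⟩ := hA
    exact ⟨fun p => B (f p.1, p.2), ih hB (by fun_prop), fun a => h (f a)⟩

theorem not_succ {n : ℕ} {A : α → Prop} (hA : Sig n A) : Sig (n + 1) fun a => ¬ A a :=
  ⟨fun p => A p.1, hA.comp Primrec.fst, fun a => by simp⟩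

theorem succ {n : ℕ} {A : α → Prop} (hA : Sig n A) : Sig (n + 1) A := by
  induction n generalizing α with
  | zero => exact (not_succ (n := 0) (PrimrecPred.not hA)).of_iff fun a => by simp
  | succ n ih =>
    obtain ⟨B, hB, h⟩ := hA
    exact ⟨B, ih hB, h⟩

theorem of_primrecPred {A : α → Prop} (hA : PrimrecPred A) (n : ℕ) : Sig n A := by
  induction n with
  | zero => exact hA
  | succ n ih => exact ih.succ

theorem exists_nat {n : ℕ} {A : α × ℕ → Prop} (hA : Sig (n + 1) A) :
    Sig (n + 1) fun a => ∃ y, A (a, y) := by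
  obtain ⟨B, hB, h⟩ := hA
  refine ⟨fun p => B ((p.1, p.2.unpair.1), p.2.unpair.2), hB.comp (by fun_prop), fun a => ?_⟩
  constructor
  · rintro ⟨y, hy⟩
    obtain ⟨z, hz⟩ := (h _).1 hy
    exact ⟨Nat.pair y z, by simpa using hz⟩
  · rintro ⟨w, hw⟩
    exact ⟨w.unpair.1, (h _).2 ⟨w.unpair.2, hw⟩⟩

theorem and_or {n : ℕ} {A B : α → Prop} (hA : Sig n A) (hB : Sig n B) :
    (Sig n fun a => A a ∧ B a) ∧ Sig n fun a => A a ∨ B a := by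
  induction n generalizing α with
  | zero => exact ⟨PrimrecPred.and hA hB, PrimrecPred.or hA hB⟩
  | succ n ih =>
    obtain ⟨C, hC, hA⟩ := hA
    obtain ⟨D, hD, hB⟩ := hB
    constructor
    · refine ⟨fun p => C (p.1, p.2.unpair.1) ∨ D (p.1, p.2.unpair.2),
        (ih (hC.comp (by fun_prop)) (hD.comp (by fun_prop))).2, fun a => ?_⟩
      simp only [hA, hB]
      constructor
      · rintro ⟨⟨y, hy⟩, z, hz⟩
        exact ⟨Nat.pair y z, by simpa using ⟨hy, hz⟩⟩
      · rintro ⟨w, hw⟩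
        push Not at hw
        exact ⟨⟨_, hw.1⟩, _, hw.2⟩
    · refine ⟨fun p => C p ∧ D p, (ih hC hD).1, fun a => ?_⟩
      simp only [hA, hB, ← exists_or]
      exact exists_congr fun y => not_and_or.symm

theorem and {n : ℕ} {A B : α → Prop} (hA : Sig n A) (hB : Sig n B) :
    Sig n fun a => A a ∧ B a := (and_or hA hB).1

theorem or {n : ℕ} {A B : α → Prop} (hA : Sig n A) (hB : Sig n B) :
    Sig n fun a => A a ∨ B a := (and_or hA hB).2

theorem bounded {n : ℕ} {A : α × ℕ → Prop} (hA : Sig n A) {f : α → ℕ} (hf : Primrec f) :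
    (Sig n fun a => ∀ y < f a, A (a, y)) ∧ Sig n fun a => ∃ y < f a, A (a, y) := by
  induction n generalizing α with
  | zero =>
    have hR : PrimrecRel fun (y : ℕ) (a : α) => A (a, y) :=
      PrimrecPred.comp (p := A) (f := fun q : ℕ × α => (q.2, q.1)) hA (by fun_prop)
    have hr : Primrec fun a => List.range (f a) := Primrec.list_range.comp hf
    exact ⟨(hR.forall_mem_list.comp hr Primrec.id).of_eq (by simp),
      (hR.exists_mem_list.comp hr Primrec.id).of_eq (by simp)⟩
  | succ n ih =>
    obtain ⟨B, hB, h⟩ := hA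
    constructor
    · refine ⟨fun p => ∃ y < f p.1, B ((p.1, y), (listOf p.2).getD y 0),
        (ih (A := fun q : (α × ℕ) × ℕ => B ((q.1.1, q.2), (listOf q.1.2).getD q.2 0))
          (hB.comp (by fun_prop)) (f := fun p => f p.1) (by fun_prop)).2, fun a => ?_⟩
      constructor
      · intro H
        have H' : ∀ y, ∃ z, y < f a → ¬ B ((a, y), z) := fun y => by
          by_cases hy : y < f a
          · obtain ⟨z, hz⟩ := (h _).1 (H y hy)
            exact ⟨z, fun _ => hz⟩
          · exact ⟨0, fun h => (hy h).elim⟩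
        choose g hg using H'
        refine ⟨Encodable.encode ((List.range (f a)).map g), ?_⟩
        rintro ⟨y, hy, hB⟩
        refine hg y hy ?_
        simpa [List.getD_eq_getElem?_getD, hy] using hB
      · rintro ⟨w, hw⟩ y hy
        exact (h _).2 ⟨_, fun hB => hw ⟨y, hy, hB⟩⟩
    · refine ⟨fun p => ∀ y < f p.1, B ((p.1, y), p.2),
        (ih (A := fun q : (α × ℕ) × ℕ => B ((q.1.1, q.2), q.1.2))
          (hB.comp (by fun_prop)) (f := fun p => f p.1) (by fun_prop)).1, fun a => ?_⟩
      simp only [h, not_forall]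
      constructor
      · rintro ⟨y, hy, z, hz⟩
        exact ⟨z, y, hy, hz⟩
      · rintro ⟨z, y, hy, hz⟩
        exact ⟨y, hy, z, hz⟩

theorem forall_lt {n : ℕ} {A : α × ℕ → Prop} (hA : Sig n A) {f : α → ℕ} (hf : Primrec f) :
    Sig n fun a => ∀ y < f a, A (a, y) := (bounded hA hf).1

theorem exists_lt {n : ℕ} {A : α × ℕ → Prop} (hA : Sig n A) {f : α → ℕ} (hf : Primrec f) :
    Sig n fun a => ∃ y < f a, A (a, y) := (bounded hA hf).2

end Sig

/-! ### Realization of terms and bounded quantifiers -/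

section Realize

variable {M : Type} [LA.Structure M] {k : ℕ}

theorem realize_liftT (t : LA.Term (Empty ⊕ Fin k)) (v : Empty → M) (xs : Fin k → M) (a : M) :
    (liftT t).realize (Sum.elim v (Fin.snoc xs a : Fin (k + 1) → M)) =
      t.realize (Sum.elim v xs) := by
  rw [liftT, Term.realize_relabel]
  congr 1
  funext i
  rcases i with i | i
  · rfl
  · simp

theorem realize_leF (t s : LA.Term (Empty ⊕ Fin k)) (v : Empty → M) (xs : Fin k → M) :
    (leF t s).Realize v xs ↔ Structure.RelMap (L := LA) ArithRel.le
      ![t.realize (Sum.elim v xs), s.realize (Sum.elim v xs)] := by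
  change Structure.RelMap (L := LA) ArithRel.le
    (fun i => (![t, s] i).realize (Sum.elim v xs)) ↔ _
  rw [show (fun i => (![t, s] i).realize (Sum.elim v xs)) =
    ![t.realize (Sum.elim v xs), s.realize (Sum.elim v xs)] by funext i; fin_cases i <;> rfl]

theorem realize_bdall (t : LA.Term (Empty ⊕ Fin k)) (φ : LA.BoundedFormula Empty (k + 1))
    (v : Empty → M) (xs : Fin k → M) :
    ((leF (&(Fin.last k)) (liftT t) ⟹ φ).all).Realize v xs ↔
      ∀ a : M, Structure.RelMap (L := LA) ArithRel.le ![a, t.realize (Sum.elim v xs)] →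
        φ.Realize v (Fin.snoc xs a) := by
  simp only [realize_all, realize_imp, realize_leF, realize_liftT]
  simp

theorem realize_bdex (t : LA.Term (Empty ⊕ Fin k)) (φ : LA.BoundedFormula Empty (k + 1))
    (v : Empty → M) (xs : Fin k → M) :
    ((leF (&(Fin.last k)) (liftT t) ⊓ φ).ex).Realize v xs ↔
      ∃ a : M, Structure.RelMap (L := LA) ArithRel.le ![a, t.realize (Sum.elim v xs)] ∧
        φ.Realize v (Fin.snoc xs a) := by
  simp only [realize_ex, realize_inf, realize_leF, realize_liftT]
  simp

theorem nat_relMap_le (a b : ℕ) : Structure.RelMap (L := LA) ArithRel.le ![a, b] ↔ a ≤ b :=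
  Iff.rfl

end Realize

/-! ### Negation exchanges `Σₙ` and `Πₙ` -/

theorem IsSigma.exists_isPi_not {n k : ℕ} {φ : LA.BoundedFormula Empty k} (h : IsSigma n φ) :
    ∃ ψ : LA.BoundedFormula Empty k, IsPi n ψ ∧
      ∀ v xs, ψ.Realize (M := ℕ) v xs ↔ ¬ φ.Realize v xs := by
  refine IsSigma.rec
    (motive_1 := fun n {k} φ _ => ∃ ψ : LA.BoundedFormula Empty k, IsPi n ψ ∧
      ∀ v xs, ψ.Realize (M := ℕ) v xs ↔ ¬ φ.Realize v xs)
    (motive_2 := fun n {k} φ _ => ∃ ψ : LA.BoundedFormula Empty k, IsSigma n ψ ∧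
      ∀ v xs, ψ.Realize (M := ℕ) v xs ↔ ¬ φ.Realize v xs)
    ?_ ?_ ?_ ?_ ?_ ?_ ?_ ?_ ?_ ?_ ?_ ?_ h
  · exact fun {k φ} h => ⟨φ ⟹ ⊥, .ofDelta0 (.imp h .falsum), fun v xs => by simp⟩
  · exact fun {n k φ} _ ⟨ψ, h, hψ⟩ => ⟨ψ, .ofSigma h, hψ⟩
  · exact fun {n k φ} _ ⟨ψ, h, hψ⟩ => ⟨ψ.all, .all h, fun v xs => by simp [hψ]⟩
  · exact fun {n k φ χ} _ _ ⟨ψ, h, hψ⟩ ⟨θ, h', hθ⟩ => ⟨ψ ⊔ θ, .sup h h', fun v xs => by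
      simp [hψ, hθ, imp_iff_not_or]⟩
  · exact fun {n k φ χ} _ _ ⟨ψ, h, hψ⟩ ⟨θ, h', hθ⟩ => ⟨ψ ⊓ θ, .inf h h', fun v xs => by
      simp [hψ, hθ]⟩
  · exact fun {n k} t φ _ ⟨ψ, h, hψ⟩ => ⟨_, .bdex t h, fun v xs => by
      rw [realize_bdex, realize_bdall]; simp [hψ]⟩
  · exact fun {k φ} h => ⟨φ ⟹ ⊥, .ofDelta0 (.imp h .falsum), fun v xs => by simp⟩
  · exact fun {n k φ} _ ⟨ψ, h, hψ⟩ => ⟨ψ, .ofPi h, hψ⟩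
  · exact fun {n k φ} _ ⟨ψ, h, hψ⟩ => ⟨ψ.ex, .ex h, fun v xs => by simp [hψ]⟩
  · exact fun {n k φ χ} _ _ ⟨ψ, h, hψ⟩ ⟨θ, h', hθ⟩ => ⟨ψ ⊔ θ, .sup h h', fun v xs => by
      simp [hψ, hθ, imp_iff_not_or]⟩
  · exact fun {n k φ χ} _ _ ⟨ψ, h, hψ⟩ ⟨θ, h', hθ⟩ => ⟨ψ ⊓ θ, .inf h h', fun v xs => by
      simp [hψ, hθ]⟩
  · exact fun {n k} t φ _ ⟨ψ, h, hψ⟩ => ⟨_, .bdall t h, fun v xs => by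
      rw [realize_bdex, realize_bdall]; simp [hψ]⟩

theorem Delta0.isSigma_isPi {k : ℕ} {φ : LA.BoundedFormula Empty k} (h : Delta0 φ) (n : ℕ) :
    IsSigma n φ ∧ IsPi n φ := by
  induction n with
  | zero => exact ⟨.ofDelta0 h, .ofDelta0 h⟩
  | succ n ih => exact ⟨.ofPi ih.2, .ofSigma ih.1⟩

/-! ### `Σₙ`-definable relations -/

/-- The relation `R` is defined in `ℕ` by a `Σₙ`-formula. -/
def SigmaRel (n : ℕ) {k : ℕ} (R : (Fin k → ℕ) → Prop) : Prop :=
  ∃ φ : LA.BoundedFormula Empty k, IsSigma n φ ∧ ∀ v xs, φ.Realize v xs ↔ R xs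

/-- The function `f` is the value of a term. -/
def IsTermFun {k : ℕ} (f : (Fin k → ℕ) → ℕ) : Prop :=
  ∃ t : LA.Term (Empty ⊕ Fin k), ∀ v xs, t.realize (Sum.elim v xs) = f xs

namespace IsTermFun

variable {k : ℕ} {f g : (Fin k → ℕ) → ℕ}

theorem apply (i : Fin k) : IsTermFun fun xs : Fin k → ℕ => xs i :=
  ⟨Term.var (Sum.inr i), fun _ _ => rfl⟩

theorem init (hf : IsTermFun f) : IsTermFun fun xs : Fin (k + 1) → ℕ => f (Fin.init xs) := by
  obtain ⟨t, ht⟩ := hf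
  refine ⟨liftT t, fun v xs => ?_⟩
  change _ = f (Fin.init xs)
  rw [← ht v, ← realize_liftT t v (Fin.init xs) (xs (Fin.last k)), Fin.snoc_init_self]

theorem zero : IsTermFun fun _ : Fin k → ℕ => 0 := ⟨zeroT, fun _ _ => rfl⟩

theorem succ (hf : IsTermFun f) : IsTermFun fun xs => f xs + 1 := by
  obtain ⟨t, ht⟩ := hf
  exact ⟨succT t, fun v xs => congrArg (· + 1) (ht v xs)⟩

theorem add (hf : IsTermFun f) (hg : IsTermFun g) : IsTermFun fun xs => f xs + g xs := by
  obtain ⟨t, ht⟩ := hf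
  obtain ⟨s, hs⟩ := hg
  exact ⟨addT t s, fun v xs => congrArg₂ (· + ·) (ht v xs) (hs v xs)⟩

theorem mul (hf : IsTermFun f) (hg : IsTermFun g) : IsTermFun fun xs => f xs * g xs := by
  obtain ⟨t, ht⟩ := hf
  obtain ⟨s, hs⟩ := hg
  exact ⟨mulT t s, fun v xs => congrArg₂ (· * ·) (ht v xs) (hs v xs)⟩

end IsTermFun

namespace SigmaRel

variable {n k : ℕ}

theorem of_iff {R S : (Fin k → ℕ) → Prop} (h : SigmaRel n S) (hRS : ∀ xs, R xs ↔ S xs) :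
    SigmaRel n R := by
  have : R = S := funext fun xs => propext (hRS xs)
  rwa [this]

theorem eq {f g : (Fin k → ℕ) → ℕ} (hf : IsTermFun f) (hg : IsTermFun g) :
    SigmaRel n fun xs => f xs = g xs := by
  obtain ⟨t, ht⟩ := hf
  obtain ⟨s, hs⟩ := hg
  exact ⟨t =' s, ((Delta0.equal t s).isSigma_isPi n).1, fun v xs => by
    rw [realize_bdEqual, ht, hs]⟩

theorem le {f g : (Fin k → ℕ) → ℕ} (hf : IsTermFun f) (hg : IsTermFun g) :
    SigmaRel n fun xs => f xs ≤ g xs := by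
  obtain ⟨t, ht⟩ := hf
  obtain ⟨s, hs⟩ := hg
  exact ⟨leF t s, ((Delta0.le t s).isSigma_isPi n).1, fun v xs => by
    rw [realize_leF, ht, hs, nat_relMap_le]⟩

theorem and {R S : (Fin k → ℕ) → Prop} (hR : SigmaRel (n + 1) R) (hS : SigmaRel (n + 1) S) :
    SigmaRel (n + 1) fun xs => R xs ∧ S xs := by
  obtain ⟨φ, hφ, h⟩ := hR
  obtain ⟨ψ, hψ, h'⟩ := hS
  exact ⟨φ ⊓ ψ, .inf hφ hψ, fun v xs => by rw [realize_inf, h, h']⟩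

theorem or {R S : (Fin k → ℕ) → Prop} (hR : SigmaRel (n + 1) R) (hS : SigmaRel (n + 1) S) :
    SigmaRel (n + 1) fun xs => R xs ∨ S xs := by
  obtain ⟨φ, hφ, h⟩ := hR
  obtain ⟨ψ, hψ, h'⟩ := hS
  exact ⟨φ ⊔ ψ, .sup hφ hψ, fun v xs => by rw [realize_sup, h, h']⟩

theorem exists' {R : (Fin k → ℕ) → ℕ → Prop}
    (hR : SigmaRel (n + 1) fun xs : Fin (k + 1) → ℕ => R (Fin.init xs) (xs (Fin.last k))) :
    SigmaRel (n + 1) fun xs => ∃ y, R xs y := by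
  obtain ⟨φ, hφ, h⟩ := hR
  exact ⟨φ.ex, .ex hφ, fun v xs => by simp [h]⟩

theorem forall_le {R : (Fin k → ℕ) → ℕ → Prop} {f : (Fin k → ℕ) → ℕ} (hf : IsTermFun f)
    (hR : SigmaRel (n + 1) fun xs : Fin (k + 1) → ℕ => R (Fin.init xs) (xs (Fin.last k))) :
    SigmaRel (n + 1) fun xs => ∀ y ≤ f xs, R xs y := by
  obtain ⟨φ, hφ, h⟩ := hR
  obtain ⟨t, ht⟩ := hf
  exact ⟨_, .bdall t hφ, fun v xs => by
    rw [realize_bdall, ht]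
    simp [h, nat_relMap_le]⟩

theorem succ_not {R : (Fin k → ℕ) → Prop} (hR : SigmaRel n R) :
    SigmaRel (n + 1) fun xs => ¬ R xs := by
  obtain ⟨φ, hφ, h⟩ := hR
  obtain ⟨ψ, hψ, h'⟩ := hφ.exists_isPi_not
  exact ⟨ψ, .ofPi hψ, fun v xs => by rw [h', h]⟩

variable {a b c : (Fin k → ℕ) → ℕ}

theorem pair (ha : IsTermFun a) (hb : IsTermFun b) (hc : IsTermFun c) :
    SigmaRel (n + 1) fun xs => Nat.pair (a xs) (b xs) = c xs := by
  refine (or (and (le ha.succ hb) (eq ((hb.mul hb).add ha) hc))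
    (and (le hb ha) (eq (((ha.mul ha).add ha).add hb) hc))).of_iff fun xs => ?_
  unfold Nat.pair
  split_ifs <;> constructor <;> intro h <;> omega

theorem mod (ha : IsTermFun a) (hb : IsTermFun b) (hc : IsTermFun c) :
    SigmaRel (n + 1) fun xs => a xs % (b xs + 1) = c xs := by
  refine (and (le hc hb) (exists' (R := fun xs q => q * (b xs + 1) + c xs = a xs)
    (eq (((IsTermFun.apply _).mul hb.init.succ).add hc.init) ha.init))).of_iff fun xs => ?_
  constructor
  · intro h
    refine ⟨?_, a xs / (b xs + 1), ?_⟩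
    · have := Nat.mod_lt (a xs) (show 0 < b xs + 1 by omega)
      rw [h] at this
      exact Nat.le_of_lt_succ this
    · rw [← h, mul_comm]
      exact Nat.div_add_mod _ _
  · rintro ⟨h, q, hq⟩
    rw [← hq, Nat.mul_comm, Nat.mul_add_mod, Nat.mod_eq_of_lt (by omega)]

/-- The relation `β(a, b) = c` for Gödel's function `β`. -/
theorem beta (ha : IsTermFun a) (hb : IsTermFun b) (hc : IsTermFun c) :
    SigmaRel (n + 1) fun xs => Nat.beta (a xs) (b xs) = c xs := by
  refine (exists' (R := fun xs p => ∃ q, Nat.pair p q = a xs ∧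
      p % ((b xs + 1) * q + 1) = c xs)
    (exists' (R := fun xs q => Nat.pair (xs (Fin.last k)) q = a (Fin.init xs) ∧
      xs (Fin.last k) % ((b (Fin.init xs) + 1) * q + 1) = c (Fin.init xs))
      (and (pair (IsTermFun.apply _).init (IsTermFun.apply _) ha.init.init)
        (mod (IsTermFun.apply _).init (hb.init.init.succ.mul (IsTermFun.apply _))
          hc.init.init)))).of_iff fun xs => ?_
  constructor
  · exact fun h => ⟨_, _, Nat.pair_unpair _, h⟩
  · rintro ⟨p, q, h, h'⟩
    rw [Nat.beta, ← h, Nat.unpair_pair]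
    exact h'

/-- The graph of a primitive recursive function is `Σ₁`. -/
theorem primrec {f : ℕ → ℕ} (hf : Nat.Primrec f) {k : ℕ} {a b : (Fin k → ℕ) → ℕ}
    (ha : IsTermFun a) (hb : IsTermFun b) : SigmaRel (n + 1) fun xs => f (a xs) = b xs := by
  induction hf generalizing k with
  | zero => exact eq .zero hb
  | succ => exact eq ha.succ hb
  | left =>
    refine (exists' (R := fun xs q => Nat.pair (b xs) q = a xs)
      (pair hb.init (IsTermFun.apply _) ha.init)).of_iff fun xs => ?_
    constructor
    · rintro h
      exact ⟨_, by rw [← h]; exact Nat.pair_unpair _⟩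
    · rintro ⟨q, hq⟩
      simp [← hq]
  | right =>
    refine (exists' (R := fun xs q => Nat.pair q (b xs) = a xs)
      (pair (IsTermFun.apply _) hb.init ha.init)).of_iff fun xs => ?_
    constructor
    · rintro h
      exact ⟨_, by rw [← h]; exact Nat.pair_unpair _⟩
    · rintro ⟨q, hq⟩
      simp [← hq]
  | @pair f g _ _ ihf ihg =>
    refine (exists' (R := fun xs p => ∃ q, f (a xs) = p ∧ g (a xs) = q ∧ Nat.pair p q = b xs)
      (exists' (R := fun xs q => f (a (Fin.init xs)) = xs (Fin.last k) ∧
        g (a (Fin.init xs)) = q ∧ Nat.pair (xs (Fin.last k)) q = b (Fin.init xs))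
        (and (ihf ha.init.init (IsTermFun.apply _).init)
          (and (ihg ha.init.init (IsTermFun.apply _))
            (pair (IsTermFun.apply _).init (IsTermFun.apply _) hb.init.init))))).of_iff
      fun xs => by simp
  | @comp f g _ _ ihf ihg =>
    exact (exists' (R := fun xs p => g (a xs) = p ∧ f p = b xs)
      (and (ihg ha.init (IsTermFun.apply _)) (ihf (IsTermFun.apply _) hb.init))).of_iff
      fun xs => by simp
  | @prec f g _ _ ihf ihg =>
    have hstep : ∀ {m : ℕ} {z y s : (Fin m → ℕ) → ℕ}, IsTermFun z → IsTermFun y →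
        IsTermFun s → SigmaRel (n + 1) fun xs =>
          g (Nat.pair (z xs) (Nat.pair (y xs) (Nat.beta (s xs) (y xs)))) =
            Nat.beta (s xs) (y xs + 1) := by
      intro m z y s hz hy hs
      refine (exists' (R := fun xs c => Nat.beta (s xs) (y xs) = c ∧
        ∃ d, Nat.pair (y xs) c = d ∧ ∃ e, Nat.pair (z xs) d = e ∧
          ∃ h, Nat.beta (s xs) (y xs + 1) = h ∧ g e = h)
        (and (beta hs.init hy.init (IsTermFun.apply _))
        (exists' (R := fun xs d => Nat.pair (y (Fin.init xs)) (xs (Fin.last _)) = d ∧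
          ∃ e, Nat.pair (z (Fin.init xs)) d = e ∧
          ∃ h, Nat.beta (s (Fin.init xs)) (y (Fin.init xs) + 1) = h ∧ g e = h)
        (and (pair hy.init.init (IsTermFun.apply _).init (IsTermFun.apply _))
        (exists' (R := fun xs e => Nat.pair (z (Fin.init (Fin.init xs))) (xs (Fin.last _)) = e ∧
          ∃ h, Nat.beta (s (Fin.init (Fin.init xs))) (y (Fin.init (Fin.init xs)) + 1) = h ∧
            g e = h)
        (and (pair hz.init.init.init (IsTermFun.apply _).init (IsTermFun.apply _))
        (exists' (R := fun xs h => Nat.beta (s (Fin.init (Fin.init (Fin.init xs))))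
            (y (Fin.init (Fin.init (Fin.init xs))) + 1) = h ∧ g (xs (Fin.last _)) = h)
        (and (beta hs.init.init.init.init hy.init.init.init.init.succ (IsTermFun.apply _))
          (ihg (IsTermFun.apply _).init (IsTermFun.apply _)))))))))).of_iff fun xs => by simp
    have hzero : ∀ {m : ℕ} {z s : (Fin m → ℕ) → ℕ}, IsTermFun z →
        IsTermFun s → SigmaRel (n + 1) fun xs => f (z xs) = Nat.beta (s xs) 0 := by
      intro m z s hz hs
      exact (exists' (R := fun xs c => Nat.beta (s xs) 0 = c ∧ f (z xs) = c)
        (and (beta hs.init .zero (IsTermFun.apply _))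
          (ihf hz.init (IsTermFun.apply _)))).of_iff fun xs => by simp
    refine (exists' (R := fun xs z => ∃ w, Nat.pair z w = a xs ∧ ∃ s, f z = Nat.beta s 0 ∧
        (∀ y ≤ w, w ≤ y ∨ g (Nat.pair z (Nat.pair y (Nat.beta s y))) = Nat.beta s (y + 1)) ∧
          Nat.beta s w = b xs)
      (exists' (R := fun xs w => Nat.pair (xs (Fin.last _)) w = a (Fin.init xs) ∧
          ∃ s, f (xs (Fin.last _)) = Nat.beta s 0 ∧
          (∀ y ≤ w, w ≤ y ∨ g (Nat.pair (xs (Fin.last _)) (Nat.pair y (Nat.beta s y))) =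
            Nat.beta s (y + 1)) ∧ Nat.beta s w = b (Fin.init xs))
      (and (pair (IsTermFun.apply _).init (IsTermFun.apply _) ha.init.init)
      (exists' (R := fun xs s => f (Fin.init xs (Fin.last _)) = Nat.beta s 0 ∧
          (∀ y ≤ xs (Fin.last _), xs (Fin.last _) ≤ y ∨
            g (Nat.pair (Fin.init xs (Fin.last _)) (Nat.pair y (Nat.beta s y))) =
            Nat.beta s (y + 1)) ∧ Nat.beta s (xs (Fin.last _)) = b (Fin.init (Fin.init xs)))
      (and (hzero (IsTermFun.apply _).init.init (IsTermFun.apply _))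
      (and (forall_le (IsTermFun.apply _).init
        (R := fun xs y => Fin.init xs (Fin.last _) ≤ y ∨
            g (Nat.pair (Fin.init (Fin.init xs) (Fin.last _))
              (Nat.pair y (Nat.beta (xs (Fin.last _)) y))) = Nat.beta (xs (Fin.last _)) (y + 1))
        (or (le (IsTermFun.apply _).init.init (IsTermFun.apply _))
          (hstep (IsTermFun.apply _).init.init.init (IsTermFun.apply _)
            (IsTermFun.apply _).init)))
        (beta (IsTermFun.apply _) (IsTermFun.apply _).init hb.init.init.init))))))).of_iff
      fun xs => ?_
    set F : ℕ → ℕ → ℕ := fun z m => m.rec (f z) fun y IH => g (Nat.pair z (Nat.pair y IH))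
    have hF : ∀ z m, F z (m + 1) = g (Nat.pair z (Nat.pair m (F z m))) := fun _ _ => rfl
    change F (a xs).unpair.1 (a xs).unpair.2 = b xs ↔ _
    constructor
    · intro h
      set z := (a xs).unpair.1
      set w := (a xs).unpair.2
      obtain ⟨s, hs⟩ : ∃ s, ∀ i ≤ w, Nat.beta s i = F z i := by
        refine ⟨Nat.unbeta ((List.range (w + 1)).map (F z)), fun i hi => ?_⟩
        simpa using Nat.beta_unbeta_coe ((List.range (w + 1)).map (F z))
          ⟨i, by simpa using Nat.lt_succ_of_le hi⟩
      refine ⟨z, w, Nat.pair_unpair _, s, (hs 0 (Nat.zero_le _)).symm, fun y _ => ?_, ?_⟩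
      · by_cases hwy : w ≤ y
        · exact .inl hwy
        · right
          rw [hs y (by omega), hs (y + 1) (by omega), hF]
      · rw [hs w le_rfl, h]
    · rintro ⟨z, w, hzw, s, h0, hs, hb⟩
      rw [← hzw, Nat.unpair_pair, ← hb]
      have : ∀ i ≤ w, Nat.beta s i = F z i := by
        intro i
        induction i with
        | zero => exact fun _ => h0.symm
        | succ i ih =>
          intro hi
          rcases hs i (by omega) with h | h
          · omega
          · rw [← h, ih (by omega), hF]
      exact (this w le_rfl).symm

/-- Every `Σₙ₊₁`-predicate of the recursion-theoretic hierarchy is defined by a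
`Σₙ₊₁`-formula. -/
theorem of_sig {n : ℕ} {A : ℕ → Prop} (hA : Sig (n + 1) A) {k : ℕ} {a : (Fin k → ℕ) → ℕ}
    (ha : IsTermFun a) : SigmaRel (n + 1) fun xs => A (a xs) := by
  induction n generalizing A k with
  | zero =>
    obtain ⟨B, ⟨_, hB⟩, h⟩ := hA
    obtain ⟨f, hf, hfB⟩ : ∃ f : ℕ → ℕ, Nat.Primrec f ∧ ∀ p, f p = 0 ↔ ¬ B p.unpair := by
      refine ⟨fun p => Encodable.encode (decide (B p.unpair)), Primrec.nat_iff.1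
        (Primrec.encode.comp (hB.comp Primrec.unpair)), fun p => ?_⟩
      by_cases hp : B p.unpair <;> simp [hp]
    refine (exists' (R := fun xs y => ∃ p, Nat.pair (a xs) y = p ∧ f p = 0)
      (exists' (R := fun xs p => Nat.pair (a (Fin.init xs)) (xs (Fin.last _)) = p ∧ f p = 0)
        (and (pair ha.init.init (IsTermFun.apply _).init (IsTermFun.apply _))
          (primrec hf (IsTermFun.apply _) .zero)))).of_iff fun xs => ?_
    simp [h, hfB]
  | succ n ih =>
    obtain ⟨B, hB, h⟩ := hA
    have hB' : Sig (n + 1) fun p : ℕ => B p.unpair := hB.comp Primrec.unpair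
    refine (exists' (R := fun xs y => ∃ p, Nat.pair (a xs) y = p ∧ ¬ B p.unpair)
      (exists' (R := fun xs p => Nat.pair (a (Fin.init xs)) (xs (Fin.last _)) = p ∧
          ¬ B p.unpair)
        (and (pair ha.init.init (IsTermFun.apply _).init (IsTermFun.apply _))
          (succ_not (ih hB' (IsTermFun.apply _)))))).of_iff fun xs => ?_
    simp [h]

end SigmaRel

theorem piDefinable_of_sig_not {n : ℕ} {A : Set ℕ} (hA : Sig (n + 1) fun m => m ∉ A) :
    PiDefinable (n + 1) A := by
  obtain ⟨φ, hφ, h⟩ := SigmaRel.of_sig hA (IsTermFun.apply (0 : Fin 1))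
  obtain ⟨ψ, hψ, h'⟩ := hφ.exists_isPi_not
  exact ⟨ψ, hψ, fun m => by rw [h', h]; simp⟩

/-! ### Raw formulas -/

/-- Formulas with relational atoms, whose variables are de Bruijn levels: a quantifier in the
scope of `m` variables binds the variable number `m`. -/
inductive RawFormula : Type
  | atom (k i j l : ℕ)
  | and (a b : RawFormula)
  | or (a b : RawFormula)
  | neg (a : RawFormula)
  | ex (a : RawFormula)
  | bdall (i : ℕ) (a : RawFormula)

namespace RawFormula

/-- The code of a raw formula. -/
def enc : RawFormula → ℕ
  | atom k i j l => 6 * Nat.pair k (Nat.pair i (Nat.pair j l))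
  | and a b => 6 * Nat.pair a.enc b.enc + 1
  | or a b => 6 * Nat.pair a.enc b.enc + 2
  | neg a => 6 * a.enc + 3
  | ex a => 6 * a.enc + 4
  | bdall i a => 6 * Nat.pair i a.enc + 5

/-- The raw formula with a given code. -/
def dec (e : ℕ) : RawFormula :=
  if e % 6 = 0 then
    atom (e / 6).unpair.1 (e / 6).unpair.2.unpair.1 (e / 6).unpair.2.unpair.2.unpair.1
      (e / 6).unpair.2.unpair.2.unpair.2
  else if e % 6 = 1 then and (dec (e / 6).unpair.1) (dec (e / 6).unpair.2)
  else if e % 6 = 2 then or (dec (e / 6).unpair.1) (dec (e / 6).unpair.2)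
  else if e % 6 = 3 then neg (dec (e / 6))
  else if e % 6 = 4 then ex (dec (e / 6))
  else bdall (e / 6).unpair.1 (dec (e / 6).unpair.2)
termination_by e
decreasing_by
  all_goals
    have h₁ := Nat.unpair_left_le (e / 6)
    have h₂ := Nat.unpair_right_le (e / 6)
    omega

theorem dec_enc (a : RawFormula) : dec a.enc = a := by
  induction a <;> rw [dec] <;> simp [enc, Nat.mul_add_div, Nat.add_mod, *]

theorem enc_dec (e : ℕ) : (dec e).enc = e := by
  induction e using Nat.strong_induction_on with
  | _ e ih =>
    have h₁ := Nat.unpair_left_le (e / 6)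
    have h₂ := Nat.unpair_right_le (e / 6)
    rw [dec]
    split_ifs with h h h h h
    · simp [enc]; omega
    all_goals
      simp only [enc]
      first
        | rw [ih _ (by omega), ih _ (by omega), Nat.pair_unpair]; omega
        | rw [ih _ (by omega), Nat.pair_unpair]; omega
        | rw [ih _ (by omega)]; omega

/-- Raw formulas are in bijection with their codes. -/
def equivNat : RawFormula ≃ ℕ := ⟨enc, dec, dec_enc, enc_dec⟩

instance : Primcodable RawFormula := Primcodable.ofEquiv ℕ equivNat

theorem primrec_enc : Primrec enc := Primrec.encode

theorem primrec_dec : Primrec dec := Primrec.of_equiv_symm (e := equivNat)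

section Primrec

variable {α : Type} [Primcodable α]

theorem primrec_of_enc {f : α → RawFormula} {g : α → ℕ} (hg : Primrec g)
    (h : ∀ a, (f a).enc = g a) : Primrec f :=
  (primrec_dec.comp hg).of_eq fun a => by rw [← h, dec_enc]

@[fun_prop]
theorem primrec_enc_comp {f : α → RawFormula} (hf : Primrec f) : Primrec fun a => (f a).enc :=
  primrec_enc.comp hf

@[fun_prop]
theorem primrec_atom {f g h h' : α → ℕ} (hf : Primrec f) (hg : Primrec g) (hh : Primrec h)
    (hh' : Primrec h') : Primrec fun a => atom (f a) (g a) (h a) (h' a) :=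
  primrec_of_enc (g := fun a => 6 * Nat.pair (f a) (Nat.pair (g a) (Nat.pair (h a) (h' a))))
    (by fun_prop) fun _ => rfl

variable {f g : α → RawFormula}

@[fun_prop]
theorem primrec_and (hf : Primrec f) (hg : Primrec g) : Primrec fun a => and (f a) (g a) :=
  primrec_of_enc (g := fun a => 6 * Nat.pair (f a).enc (g a).enc + 1) (by fun_prop) fun _ => rfl

@[fun_prop]
theorem primrec_or (hf : Primrec f) (hg : Primrec g) : Primrec fun a => or (f a) (g a) :=
  primrec_of_enc (g := fun a => 6 * Nat.pair (f a).enc (g a).enc + 2) (by fun_prop) fun _ => rfl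

@[fun_prop]
theorem primrec_neg (hf : Primrec f) : Primrec fun a => neg (f a) :=
  primrec_of_enc (g := fun a => 6 * (f a).enc + 3) (by fun_prop) fun _ => rfl

@[fun_prop]
theorem primrec_ex (hf : Primrec f) : Primrec fun a => ex (f a) :=
  primrec_of_enc (g := fun a => 6 * (f a).enc + 4) (by fun_prop) fun _ => rfl

@[fun_prop]
theorem primrec_bdall {i : α → ℕ} (hi : Primrec i) (hf : Primrec f) :
    Primrec fun a => bdall (i a) (f a) :=
  primrec_of_enc (g := fun a => 6 * Nat.pair (i a) (f a).enc + 5) (by fun_prop) fun _ => rfl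

/-- Functions defined by structural recursion on raw formulas are primitive recursive. -/
theorem primrec_of_rec {σ : Type} [Primcodable σ] (F : RawFormula → σ)
    {f₀ : ℕ × ℕ × ℕ × ℕ → σ} {f₁ f₂ : σ × σ → σ} {f₃ f₄ : σ → σ} {f₅ : ℕ × σ → σ}
    (p₀ : Primrec f₀) (p₁ : Primrec f₁) (p₂ : Primrec f₂) (p₃ : Primrec f₃) (p₄ : Primrec f₄)
    (p₅ : Primrec f₅)
    (h₀ : ∀ k i j l, F (atom k i j l) = f₀ (k, i, j, l))
    (h₁ : ∀ a b, F (and a b) = f₁ (F a, F b)) (h₂ : ∀ a b, F (or a b) = f₂ (F a, F b))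
    (h₃ : ∀ a, F (neg a) = f₃ (F a)) (h₄ : ∀ a, F (ex a) = f₄ (F a))
    (h₅ : ∀ i a, F (bdall i a) = f₅ (i, F a)) : Primrec F := by
  let g : List σ → Option σ := fun s =>
    let e := s.length
    let p := (e / 6).unpair
    if e % 6 = 0 then
      some (f₀ (p.1, p.2.unpair.1, p.2.unpair.2.unpair.1, p.2.unpair.2.unpair.2))
    else if e % 6 = 1 then s[p.1]?.bind fun x => s[p.2]?.map fun y => f₁ (x, y)
    else if e % 6 = 2 then s[p.1]?.bind fun x => s[p.2]?.map fun y => f₂ (x, y)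
    else if e % 6 = 3 then s[e / 6]?.map f₃
    else if e % 6 = 4 then s[e / 6]?.map f₄
    else s[p.2]?.map fun x => f₅ (p.1, x)
  have hl : Primrec fun s : List σ => s.length := Primrec.list_length
  have hd : Primrec fun s : List σ => s.length / 6 := primrec_div hl (.const 6)
  have hp : Primrec fun s : List σ => (s.length / 6).unpair := primrec_unpair hd
  have hm (c : ℕ) : PrimrecPred fun s : List σ => s.length % 6 = c :=
    primrecPred_eq (primrec_mod hl (.const 6)) (.const c)
  have hget {q : List σ → ℕ} (hq : Primrec q) : Primrec fun s : List σ => s[q s]? :=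
    Primrec.list_getElem?.comp .id hq
  have h2 {f : σ × σ → σ} (pf : Primrec f) : Primrec fun s : List σ =>
      s[(s.length / 6).unpair.1]?.bind fun x => s[(s.length / 6).unpair.2]?.map fun y =>
        f (x, y) :=
    Primrec.option_bind (hget (Primrec.fst.comp hp))
      (Primrec.option_map ((hget (Primrec.snd.comp hp)).comp Primrec.fst)
        (pf.comp ((Primrec.snd.comp Primrec.fst).pair Primrec.snd)).to₂).to₂
  have hg : Primrec g := by
    refine .ite (hm 0) (Primrec.option_some.comp (p₀.comp ?_)) (.ite (hm 1) (h2 p₁)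
      (.ite (hm 2) (h2 p₂) (.ite (hm 3) (.option_map (hget hd) (p₃.comp Primrec.snd).to₂)
      (.ite (hm 4) (.option_map (hget hd) (p₄.comp Primrec.snd).to₂)
      (.option_map (hget (Primrec.snd.comp hp)) (p₅.comp (((Primrec.fst.comp hp).comp
        Primrec.fst).pair Primrec.snd)).to₂)))))
    fun_prop
  have key : Primrec₂ fun (_ : Unit) e => F (dec e) := by
    refine Primrec.nat_strong_rec _ (g := fun _ s => g s) (hg.comp Primrec.snd).to₂ ?_
    intro _ e
    have b₁ := Nat.unpair_left_le (e / 6)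
    have b₂ := Nat.unpair_right_le (e / 6)
    have hget (q : ℕ) (hq : q < e) :
        ((List.range e).map fun e => F (dec e))[q]? = some (F (dec q)) := by simp [hq]
    rw [dec]
    simp only [g, List.length_map, List.length_range]
    split_ifs with h h h h h
    · rw [h₀]
    · rw [hget _ (by omega), hget _ (by omega), h₁]; rfl
    · rw [hget _ (by omega), hget _ (by omega), h₂]; rfl
    · rw [hget _ (by omega), h₃]; rfl
    · rw [hget _ (by omega), h₄]; rfl
    · rw [hget _ (by omega), h₅]; rfl
  exact (key.comp (Primrec.const ()) primrec_enc).of_eq fun a => by rw [dec_enc]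

end Primrec

/-- The number of nested negations of a formula, not less than one if the formula is
not atomic: it bounds the position of the formula in the arithmetical hierarchy. -/
def lvl : RawFormula → ℕ
  | atom _ _ _ _ => 0
  | and a b => max 1 (max a.lvl b.lvl)
  | or a b => max 1 (max a.lvl b.lvl)
  | neg a => a.lvl + 1
  | ex a => max 1 a.lvl
  | bdall _ a => max 1 a.lvl

theorem primrec_lvl : Primrec lvl :=
  primrec_of_rec lvl (f₀ := fun _ => 0) (f₁ := fun p => max 1 (max p.1 p.2))
    (f₂ := fun p => max 1 (max p.1 p.2)) (f₃ := fun p => p + 1) (f₄ := fun p => max 1 p)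
    (f₅ := fun p => max 1 p.2) (by fun_prop) (by fun_prop) (by fun_prop) (by fun_prop)
    (by fun_prop) (by fun_prop) (fun _ _ _ _ => rfl) (fun _ _ => rfl) (fun _ _ => rfl)
    (fun _ => rfl) (fun _ => rfl) (fun _ _ => rfl)

end RawFormula

/-! ### Satisfaction of raw formulas -/

theorem ofFn_snoc {M : Type} {m : ℕ} (xs : Fin m → M) (x : M) :
    List.ofFn (Fin.snoc xs x : Fin (m + 1) → M) = List.ofFn xs ++ [x] := by
  rw [List.ofFn_succ']; simp

section Structures

variable (M : Type) [LA.Structure M]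

/-- The interpretation of `0`. -/
def zeroM : M := Structure.funMap (L := LA) ArithFunc.zero ![]

variable {M}

/-- The interpretation of `S`. -/
def succM (x : M) : M := Structure.funMap (L := LA) ArithFunc.succ ![x]

/-- The interpretation of `+`. -/
def addM (x y : M) : M := Structure.funMap (L := LA) ArithFunc.add ![x, y]

/-- The interpretation of `×`. -/
def mulM (x y : M) : M := Structure.funMap (L := LA) ArithFunc.mul ![x, y]

/-- The interpretation of `≤`. -/
def leM (x y : M) : Prop := Structure.RelMap (L := LA) ArithRel.le ![x, y]

variable {k : ℕ} (v : Empty ⊕ Fin k → M) (t s : LA.Term (Empty ⊕ Fin k))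

theorem realize_zeroT : (zeroT : LA.Term (Empty ⊕ Fin k)).realize v = zeroM M := by
  change Structure.funMap (L := LA) ArithFunc.zero (fun i => (![] i : LA.Term _).realize v) = _
  exact congrArg _ (funext fun i => i.elim0)

theorem realize_succT : (succT t).realize v = succM (t.realize v) := by
  change Structure.funMap (L := LA) ArithFunc.succ (fun i => (![t] i).realize v) = _
  exact congrArg _ (funext fun i => by fin_cases i; rfl)

theorem realize_addT : (addT t s).realize v = addM (t.realize v) (s.realize v) := by
  change Structure.funMap (L := LA) ArithFunc.add (fun i => (![t, s] i).realize v) = _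
  exact congrArg _ (funext fun i => by fin_cases i <;> rfl)

theorem realize_mulT : (mulT t s).realize v = mulM (t.realize v) (s.realize v) := by
  change Structure.funMap (L := LA) ArithFunc.mul (fun i => (![t, s] i).realize v) = _
  exact congrArg _ (funext fun i => by fin_cases i <;> rfl)

/-- The meaning of the relational atoms. -/
def AtomHolds (k : ℕ) (x y z : M) : Prop :=
  match k with
  | 0 => x = y
  | 1 => x = zeroM M
  | 2 => succM x = y
  | 3 => addM x y = z
  | 4 => mulM x y = z
  | _ => leM x y

namespace RawFormula

/-- The value of a variable. -/
def get (v : List M) (i : ℕ) : M := v.getD i (zeroM M)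

/-- Satisfaction of raw formulas. -/
def Sat : RawFormula → List M → Prop
  | atom k i j l, v => AtomHolds k (get v i) (get v j) (get v l)
  | and a b, v => a.Sat v ∧ b.Sat v
  | or a b, v => a.Sat v ∨ b.Sat v
  | neg a, v => ¬ a.Sat v
  | ex a, v => ∃ x, a.Sat (v ++ [x])
  | bdall i a, v => ∀ x, leM x (get v i) → a.Sat (v ++ [x])

/-- The term for a variable. -/
def varT (k i : ℕ) : LA.Term (Empty ⊕ Fin k) :=
  if h : i < k then Term.var (Sum.inr ⟨i, h⟩) else zeroT

/-- The first-order formula for an atom. -/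
def atomF (k m i j l : ℕ) : LA.BoundedFormula Empty m :=
  match k with
  | 0 => varT m i =' varT m j
  | 1 => varT m i =' zeroT
  | 2 => succT (varT m i) =' varT m j
  | 3 => addT (varT m i) (varT m j) =' varT m l
  | 4 => mulT (varT m i) (varT m j) =' varT m l
  | _ => leF (varT m i) (varT m j)

/-- The first-order formula corresponding to a raw formula. -/
def toF : RawFormula → (m : ℕ) → LA.BoundedFormula Empty m
  | atom k i j l, m => atomF k m i j l
  | and a b, m => a.toF m ⊓ b.toF m
  | or a b, m => a.toF m ⊔ b.toF m
  | neg a, m => ∼(a.toF m)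
  | ex a, m => (a.toF (m + 1)).ex
  | bdall i a, m => (leF (&(Fin.last m)) (liftT (varT m i)) ⟹ a.toF (m + 1)).all

theorem realize_varT {m : ℕ} (v : Empty → M) (xs : Fin m → M) (i : ℕ) :
    (varT m i).realize (Sum.elim v xs) = get (List.ofFn xs) i := by
  unfold varT get
  split_ifs with h
  · simp [h]
  · rw [realize_zeroT]; simp [h]

theorem realize_toF (a : RawFormula) {m : ℕ} (v : Empty → M) (xs : Fin m → M) :
    (a.toF m).Realize v xs ↔ a.Sat (List.ofFn xs) := by
  induction a generalizing m with
  | atom k i j l =>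
    rw [toF, Sat]
    unfold atomF AtomHolds
    split <;> simp only [realize_bdEqual, realize_leF, realize_varT, realize_zeroT,
      realize_succT, realize_addT, realize_mulT]
    rfl
  | and a b iha ihb => simp [toF, Sat, iha, ihb]
  | or a b iha ihb => simp [toF, Sat, iha, ihb]
  | neg a ih => simp [toF, Sat, ih]
  | ex a ih => simp only [toF, Sat, realize_ex, ih, ofFn_snoc]
  | bdall i a ih =>
    rw [toF, realize_bdall, realize_varT]
    simp only [ih, ofFn_snoc]
    rfl

end RawFormula

end Structures

/-! ### Translation of first-order formulas into raw formulas -/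

open RawFormula

section Translation

theorem get_append_of_lt {M : Type} [LA.Structure M] {v w : List M} {i : ℕ} (h : i < v.length) :
    get (v ++ w) i = get v i := by
  simp [RawFormula.get, List.getElem?_append_left h]

theorem get_append_length {M : Type} [LA.Structure M] {v w : List M} {x : M} {m : ℕ}
    (h : v.length = m) : get (v ++ x :: w) m = x := by
  subst h
  simp [RawFormula.get]

theorem get_append_append_of_lt {M : Type} [LA.Structure M] {v : List M} {x y : M} {i : ℕ}
    (h : i < v.length) : get (v ++ [x] ++ [y]) i = get v i := by
  rw [List.append_assoc, get_append_of_lt h]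

theorem get_append_append_length {M : Type} [LA.Structure M] {v : List M} {x y : M} {m : ℕ}
    (h : v.length = m) : get (v ++ [x] ++ [y]) m = x := by
  rw [List.append_assoc]
  exact get_append_length h

theorem get_append_append_length_succ {M : Type} [LA.Structure M] {v : List M} {x y : M} {m : ℕ}
    (h : v.length = m) : get (v ++ [x] ++ [y]) (m + 1) = y :=
  get_append_length (by simp [h])

theorem sat_ex_ex_and {M : Type} [LA.Structure M] {e e' A : RawFormula} {v : List M} {a b : M}
    (h : ∀ x y, e.Sat (v ++ [x] ++ [y]) ↔ a = x) (h' : ∀ x y, e'.Sat (v ++ [x] ++ [y]) ↔ b = y) :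
    (RawFormula.ex (.ex (.and (.and e e') A))).Sat v ↔ A.Sat (v ++ [a] ++ [b]) := by
  simp only [Sat, h, h']
  simp

/-- The term `t` is represented by raw formulas of level at most one. -/
theorem exists_rawFormula_of_term {k : ℕ} (t : LA.Term (Empty ⊕ Fin k)) (m : ℕ)
    (ρ : Fin k → ℕ) (hρ : ∀ i, ρ i < m) (o : ℕ) (ho : o < m) :
    ∃ e : RawFormula, e.lvl ≤ 1 ∧ ∀ (M : Type) [LA.Structure M] (w : Empty → M) (v : List M),
      v.length = m →
        (e.Sat v ↔ t.realize (Sum.elim w fun i => get v (ρ i)) = get v o) := by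
  induction t generalizing m o with
  | var i =>
    rcases i with i | i
    · exact i.elim
    · exact ⟨.atom 0 (ρ i) o 0, by simp [lvl], fun M _ w v hv => Iff.rfl⟩
  | func f ts ih =>
    cases f with
    | zero =>
      refine ⟨.atom 1 o 0 0, by simp [lvl], fun M _ w v hv => ?_⟩
      have : ts = ![] := funext fun i => i.elim0
      subst this
      change _ ↔ zeroT.realize _ = _
      rw [realize_zeroT]
      exact eq_comm
    | succ =>
      obtain ⟨e, he, h⟩ := ih 0 (m + 1) (fun i => (hρ i).trans (Nat.lt_succ_self m)) m
        (Nat.lt_succ_self m)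
      refine ⟨.ex (.and e (.atom 2 m o 0)), by simpa [lvl] using he, fun M _ w v hv => ?_⟩
      have hts : ts = ![ts 0] := funext fun i => by fin_cases i; rfl
      rw [hts]
      change _ ↔ (succT (ts 0)).realize _ = _
      rw [realize_succT]
      simp only [Sat, AtomHolds]
      simp only [h M w (v ++ [_]) (by simp [hv]), get_append_length hv,
        get_append_of_lt (hv ▸ ho), get_append_of_lt (hv ▸ hρ _)]
      simp
    | add =>
      obtain ⟨e, he, h⟩ := ih 0 (m + 1 + 1) (fun i => (hρ i).trans (by omega)) m (by omega)
      obtain ⟨e', he', h'⟩ := ih 1 (m + 1 + 1) (fun i => (hρ i).trans (by omega)) (m + 1)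
        (by omega)
      refine ⟨.ex (.ex (.and (.and e e') (.atom 3 m (m + 1) o))), by simp [lvl, he, he'],
        fun M _ w v hv => ?_⟩
      have hts : ts = ![ts 0, ts 1] := funext fun i => by fin_cases i <;> rfl
      rw [hts]
      change _ ↔ (addT (ts 0) (ts 1)).realize _ = _
      rw [realize_addT, sat_ex_ex_and (a := (ts 0).realize (Sum.elim w fun i => get v (ρ i)))
        (b := (ts 1).realize (Sum.elim w fun i => get v (ρ i)))]
      · simp only [Sat, AtomHolds, get_append_append_length hv,
          get_append_append_length_succ hv, get_append_append_of_lt (hv ▸ ho)]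
      · intro x y
        simp only [h M w (v ++ [x] ++ [y]) (by simp [hv]), get_append_append_length hv,
          get_append_append_of_lt (hv ▸ hρ _)]
      · intro x y
        simp only [h' M w (v ++ [x] ++ [y]) (by simp [hv]), get_append_append_length_succ hv,
          get_append_append_of_lt (hv ▸ hρ _)]
    | mul =>
      obtain ⟨e, he, h⟩ := ih 0 (m + 1 + 1) (fun i => (hρ i).trans (by omega)) m (by omega)
      obtain ⟨e', he', h'⟩ := ih 1 (m + 1 + 1) (fun i => (hρ i).trans (by omega)) (m + 1)
        (by omega)
      refine ⟨.ex (.ex (.and (.and e e') (.atom 4 m (m + 1) o))), by simp [lvl, he, he'],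
        fun M _ w v hv => ?_⟩
      have hts : ts = ![ts 0, ts 1] := funext fun i => by fin_cases i <;> rfl
      rw [hts]
      change _ ↔ (mulT (ts 0) (ts 1)).realize _ = _
      rw [realize_mulT, sat_ex_ex_and (a := (ts 0).realize (Sum.elim w fun i => get v (ρ i)))
        (b := (ts 1).realize (Sum.elim w fun i => get v (ρ i)))]
      · simp only [Sat, AtomHolds, get_append_append_length hv,
          get_append_append_length_succ hv, get_append_append_of_lt (hv ▸ ho)]
      · intro x y
        simp only [h M w (v ++ [x] ++ [y]) (by simp [hv]), get_append_append_length hv,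
          get_append_append_of_lt (hv ▸ hρ _)]
      · intro x y
        simp only [h' M w (v ++ [x] ++ [y]) (by simp [hv]), get_append_append_length_succ hv,
          get_append_append_of_lt (hv ▸ hρ _)]

/-- The formula `φ` is equivalent, uniformly in all structures, to raw formulas of level at
most `n`. -/
def Transl {k : ℕ} (φ : LA.BoundedFormula Empty k) (n : ℕ) : Prop :=
  ∀ (m : ℕ) (ρ : Fin k → ℕ), (∀ i, ρ i < m) → ∃ e : RawFormula, e.lvl ≤ n ∧
    ∀ (M : Type) [LA.Structure M] (w : Empty → M) (v : List M), v.length = m →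
      (e.Sat v ↔ φ.Realize w fun i => get v (ρ i))

namespace Transl

variable {k n : ℕ} {φ ψ : LA.BoundedFormula Empty k}

theorem mono {n' : ℕ} (h : Transl φ n) (hn : n ≤ n') : Transl φ n' := fun m ρ hρ =>
  let ⟨e, he, h⟩ := h m ρ hρ
  ⟨e, he.trans hn, h⟩

theorem congr (h : Transl φ n) (hφ : ∀ (M : Type) [LA.Structure M] (w : Empty → M)
    (xs : Fin k → M), ψ.Realize w xs ↔ φ.Realize w xs) : Transl ψ n := fun m ρ hρ =>
  let ⟨e, he, h⟩ := h m ρ hρ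
  ⟨e, he, fun M _ w v hv => by rw [h M w v hv, hφ]⟩

theorem not (h : Transl φ n) : Transl (∼φ) (n + 1) := fun m ρ hρ =>
  let ⟨e, he, h⟩ := h m ρ hρ
  ⟨.neg e, Nat.succ_le_succ he, fun M _ w v hv => by rw [realize_not, ← h M w v hv, Sat]⟩

theorem inf (h : Transl φ (n + 1)) (h' : Transl ψ (n + 1)) : Transl (φ ⊓ ψ) (n + 1) :=
  fun m ρ hρ =>
    let ⟨e, he, h⟩ := h m ρ hρ
    let ⟨e', he', h'⟩ := h' m ρ hρ
    ⟨.and e e', by simp [lvl, he, he'], fun M _ w v hv => by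
      rw [realize_inf, ← h M w v hv, ← h' M w v hv, Sat]⟩

theorem sup (h : Transl φ (n + 1)) (h' : Transl ψ (n + 1)) : Transl (φ ⊔ ψ) (n + 1) :=
  fun m ρ hρ =>
    let ⟨e, he, h⟩ := h m ρ hρ
    let ⟨e', he', h'⟩ := h' m ρ hρ
    ⟨.or e e', by simp [lvl, he, he'], fun M _ w v hv => by
      rw [realize_sup, ← h M w v hv, ← h' M w v hv, Sat]⟩

theorem realize_snoc_get {M : Type} [LA.Structure M] {φ : LA.BoundedFormula Empty (k + 1)}
    {m : ℕ} {ρ : Fin k → ℕ} (hρ : ∀ i, ρ i < m) {v u : List M} (hv : v.length = m)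
    (w : Empty → M) (x : M) :
    (φ.Realize w fun i => get (v ++ u ++ [x])
      ((Fin.snoc ρ (m + u.length) : Fin (k + 1) → ℕ) i)) ↔
      φ.Realize w (Fin.snoc (fun i => get v (ρ i)) x) := by
  have : (fun i => get (v ++ u ++ [x]) ((Fin.snoc ρ (m + u.length) : Fin (k + 1) → ℕ) i)) =
      Fin.snoc (fun i => get v (ρ i)) x := by
    funext i
    refine Fin.lastCases ?_ (fun i => ?_) i
    · simp only [Fin.snoc_last]
      exact get_append_length (by simp [hv])
    · simp only [Fin.snoc_castSucc, List.append_assoc]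
      exact get_append_of_lt (hv ▸ hρ i)
  rw [this]

theorem snoc_lt {m m' : ℕ} {ρ : Fin k → ℕ} (hρ : ∀ i, ρ i < m) (hm : m ≤ m') (i : Fin (k + 1)) :
    (Fin.snoc ρ m' : Fin (k + 1) → ℕ) i < m' + 1 := by
  refine Fin.lastCases ?_ (fun i => ?_) i
  · simp
  · have := hρ i
    simp only [Fin.snoc_castSucc]
    omega

theorem ex {φ : LA.BoundedFormula Empty (k + 1)} (h : Transl φ (n + 1)) :
    Transl φ.ex (n + 1) := fun m ρ hρ => by
  obtain ⟨e, he, h⟩ := h (m + 1) (Fin.snoc ρ m) (snoc_lt hρ le_rfl)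
  refine ⟨.ex e, by simp [lvl, he], fun M _ w v hv => ?_⟩
  rw [realize_ex, Sat]
  refine exists_congr fun x => ?_
  rw [h M w _ (by simp [hv])]
  simpa using realize_snoc_get (u := []) hρ hv w x

theorem bdall {φ : LA.BoundedFormula Empty (k + 1)} (t : LA.Term (Empty ⊕ Fin k))
    (h : Transl φ (n + 1)) :
    Transl (leF (&(Fin.last k)) (liftT t) ⟹ φ).all (n + 1) := fun m ρ hρ => by
  obtain ⟨e, he, h⟩ := h (m + 1 + 1) (Fin.snoc ρ (m + 1)) (snoc_lt hρ (by omega))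
  obtain ⟨e', he', h'⟩ := exists_rawFormula_of_term t (m + 1) ρ (fun i => (hρ i).trans (by omega))
    m (by omega)
  refine ⟨.ex (.and e' (.bdall m e)), by simp [lvl, he]; omega, fun M _ w v hv => ?_⟩
  rw [realize_bdall]
  simp only [Sat]
  simp only [h' M w (v ++ [_]) (by simp [hv]), get_append_length hv,
    get_append_of_lt (hv ▸ hρ _)]
  rw [exists_eq_left']
  refine forall_congr' fun x => imp_congr Iff.rfl ?_
  rw [h M w _ (by simp [hv])]
  exact realize_snoc_get (u := [_]) hρ hv w x

theorem falsum : Transl (⊥ : LA.BoundedFormula Empty k) 1 := fun _ _ _ =>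
  ⟨.neg (.atom 0 0 0 0), by simp [lvl], fun M _ w v hv => by simp [Sat, AtomHolds]⟩

theorem not_falsum : Transl (∼(⊥ : LA.BoundedFormula Empty k)) 1 := fun _ _ _ =>
  ⟨.atom 0 0 0 0, by simp [lvl], fun M _ w v hv => by simp [Sat, AtomHolds]⟩

/-- Literals with two term arguments. -/
theorem literal (t s : LA.Term (Empty ⊕ Fin k)) {A : ℕ → ℕ → RawFormula}
    (hA : ∀ i j, (A i j).lvl ≤ 1) {R : ∀ (M : Type) [LA.Structure M], M → M → Prop}
    (h : ∀ (M : Type) [LA.Structure M] (v : List M) (i j : ℕ),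
      (A i j).Sat v ↔ R M (get v i) (get v j))
    (hφ : ∀ (M : Type) [LA.Structure M] (w : Empty → M) (xs : Fin k → M), φ.Realize w xs ↔
      R M (t.realize (Sum.elim w xs)) (s.realize (Sum.elim w xs))) :
    Transl φ 1 := fun m ρ hρ => by
  obtain ⟨e, he, h₁⟩ := exists_rawFormula_of_term t (m + 1 + 1) ρ
    (fun i => (hρ i).trans (by omega)) m (by omega)
  obtain ⟨e', he', h₂⟩ := exists_rawFormula_of_term s (m + 1 + 1) ρ
    (fun i => (hρ i).trans (by omega)) (m + 1) (by omega)
  refine ⟨.ex (.ex (.and (.and e e') (A m (m + 1)))), by simp [lvl, he, he', hA],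
    fun M _ w v hv => ?_⟩
  rw [hφ, sat_ex_ex_and (a := t.realize (Sum.elim w fun i => get v (ρ i)))
    (b := s.realize (Sum.elim w fun i => get v (ρ i)))]
  · simp only [h, get_append_append_length hv, get_append_append_length_succ hv]
  · intro x y
    simp only [h₁ M w (v ++ [x] ++ [y]) (by simp [hv]), get_append_append_length hv,
      get_append_append_of_lt (hv ▸ hρ _)]
  · intro x y
    simp only [h₂ M w (v ++ [x] ++ [y]) (by simp [hv]), get_append_append_length_succ hv,
      get_append_append_of_lt (hv ▸ hρ _)]

theorem of_delta0 (h : Delta0 φ) : Transl φ 1 ∧ Transl (∼φ) 1 := by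
  induction h with
  | falsum => exact ⟨falsum, not_falsum⟩
  | equal t s =>
    exact ⟨literal t s (A := fun i j => .atom 0 i j 0) (R := fun M _ x y => x = y)
        (by simp [lvl]) (fun M _ v i j => Iff.rfl) (fun M _ w xs => by simp),
      literal t s (A := fun i j => .neg (.atom 0 i j 0)) (R := fun M _ x y => x ≠ y)
        (by simp [lvl]) (fun M _ v i j => Iff.rfl) (fun M _ w xs => by simp)⟩
  | le t s =>
    exact ⟨literal t s (A := fun i j => .atom 5 i j 0) (R := fun M _ x y => leM x y)
        (by simp [lvl]) (fun M _ v i j => Iff.rfl) (fun M _ w xs => realize_leF ..),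
      literal t s (A := fun i j => .neg (.atom 5 i j 0)) (R := fun M _ x y => ¬ leM x y)
        (by simp [lvl]) (fun M _ v i j => Iff.rfl)
        (fun M _ w xs => by rw [realize_not, realize_leF]; rfl)⟩
  | imp _ _ ih₁ ih₂ =>
    exact ⟨(ih₁.2.sup ih₂.1).congr fun M _ w xs => by simp [imp_iff_not_or],
      (ih₁.1.inf ih₂.2).congr fun M _ w xs => by simp⟩
  | bdall t _ ih =>
    refine ⟨ih.1.bdall t, ?_⟩
    have hle : Transl (leF (&(Fin.last _)) (liftT t)) 1 :=
      literal _ _ (A := fun i j => .atom 5 i j 0) (R := fun M _ x y => leM x y)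
        (by simp [lvl]) (fun M _ v i j => Iff.rfl) (fun M _ w xs => realize_leF ..)
    exact (hle.inf ih.2).ex.congr fun M _ w xs => by simp

theorem of_isSigma_isPi : ∀ {n k : ℕ} {φ : LA.BoundedFormula Empty k}, IsPi n φ →
    Transl (∼φ) (max 1 n) ∧ (n = 0 → Transl φ 1) := by
  refine @IsPi.rec
    (motive_1 := fun n {k} φ _ => Transl φ (max 1 n) ∧ (n = 0 → Transl (∼φ) 1))
    (motive_2 := fun n {k} φ _ => Transl (∼φ) (max 1 n) ∧ (n = 0 → Transl φ 1))
    ?_ ?_ ?_ ?_ ?_ ?_ ?_ ?_ ?_ ?_ ?_ ?_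
  · exact fun h => ⟨(of_delta0 h).1, fun _ => (of_delta0 h).2⟩
  · rintro (_ | n) k φ _ ⟨h, h'⟩
    · exact ⟨(h' rfl).mono (by simp), by simp⟩
    · exact ⟨(h.not.mono (by simp)).congr fun M _ w xs => by simp, by simp⟩
  · intro n k φ _ h
    rw [max_eq_right (by omega)] at *
    exact ⟨h.1.ex, by simp⟩
  · intro n k φ ψ _ _ h h'
    rw [max_eq_right (by omega)] at *
    exact ⟨h.1.inf h'.1, by simp⟩
  · intro n k φ ψ _ _ h h'
    rw [max_eq_right (by omega)] at *
    exact ⟨h.1.sup h'.1, by simp⟩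
  · intro n k t φ _ h
    rw [max_eq_right (by omega)] at *
    exact ⟨h.1.bdall t, by simp⟩
  · exact fun h => ⟨(of_delta0 h).2, fun _ => (of_delta0 h).1⟩
  · rintro (_ | n) k φ _ ⟨h, h'⟩
    · exact ⟨(h' rfl).mono (by simp), by simp⟩
    · exact ⟨h.not.mono (by simp), by simp⟩
  · intro n k φ _ h
    rw [max_eq_right (by omega)] at *
    exact ⟨h.1.ex.congr fun M _ w xs => by simp, by simp⟩
  · intro n k φ ψ _ _ h h'
    rw [max_eq_right (by omega)] at *
    exact ⟨(h.1.sup h'.1).congr fun M _ w xs => by simp [imp_iff_not_or], by simp⟩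
  · intro n k φ ψ _ _ h h'
    rw [max_eq_right (by omega)] at *
    exact ⟨(h.1.inf h'.1).congr fun M _ w xs => by simp, by simp⟩
  · intro n k t φ _ h
    rw [max_eq_right (by omega)] at *
    exact ⟨(h.1.bdall t).congr fun M _ w xs => by simp, by simp⟩

theorem of_isPi (h : IsPi n φ) : Transl φ (n + 1) := by
  cases n with
  | zero => exact (of_isSigma_isPi h).2 rfl
  | succ n => exact ((of_isSigma_isPi h).1.not.mono (by simp)).congr fun M _ w xs => by simp

theorem exists_level (φ : LA.BoundedFormula Empty k) : ∃ n, Transl φ (n + 1) := by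
  induction φ with
  | falsum => exact ⟨0, falsum⟩
  | equal t s => exact ⟨0, (of_delta0 (.equal t s)).1⟩
  | rel R ts =>
    cases R
    have hts : ts = ![ts 0, ts 1] := funext fun i => by fin_cases i <;> rfl
    rw [hts]
    exact ⟨0, (of_delta0 (.le (ts 0) (ts 1))).1⟩
  | imp _ _ ih₁ ih₂ =>
    obtain ⟨n, h⟩ := ih₁
    obtain ⟨n', h'⟩ := ih₂
    exact ⟨n + 1 + n', ((h.not.mono (by omega)).sup (h'.mono (by omega))).congr
      fun M _ w xs => by simp [imp_iff_not_or]⟩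
  | all _ ih =>
    obtain ⟨n, h⟩ := ih
    exact ⟨n + 1 + 1, h.not.ex.not.congr fun M _ w xs => by simp⟩

theorem exists_sentence {φ : LA.Sentence} (h : Transl φ n) : ∃ e : RawFormula, e.lvl ≤ n ∧
    ∀ (M : Type) [LA.Structure M], M ⊨ φ ↔ e.Sat ([] : List M) := by
  obtain ⟨e, he, h⟩ := h 0 Fin.elim0 (fun i => i.elim0)
  refine ⟨e, he, fun M _ => ?_⟩
  rw [h M default [] rfl, Subsingleton.elim (fun i : Fin 0 => get ([] : List M) i.elim0) default]
  exact Iff.rfl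

end Transl

end Translation

/-! ### Points: raw formulas with parameters -/

/-- The code of a raw formula together with a list of parameters. -/
def pt (a : RawFormula) (v : List ℕ) : ℕ := Nat.pair a.enc (Encodable.encode v)

/-- The raw formula of a point. -/
def ptF (p : ℕ) : RawFormula := dec p.unpair.1

/-- The parameters of a point. -/
def ptV (p : ℕ) : List ℕ := listOf p.unpair.2

@[simp] theorem ptF_pt (a : RawFormula) (v : List ℕ) : ptF (pt a v) = a := by
  simp [ptF, pt, dec_enc]

@[simp] theorem ptV_pt (a : RawFormula) (v : List ℕ) : ptV (pt a v) = v := by simp [ptV, pt]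

@[simp] theorem pt_ptF_ptV (p : ℕ) : pt (ptF p) (ptV p) = p := by simp [ptF, ptV, pt, enc_dec]

namespace RawFormula

/-- The first immediate subformula of a conjunction or disjunction. -/
def fstSub (a : RawFormula) : RawFormula := dec (a.enc / 6).unpair.1

/-- The second immediate subformula of a conjunction or disjunction, and the immediate
subformula of a bounded quantification. -/
def sndSub (a : RawFormula) : RawFormula := dec (a.enc / 6).unpair.2

/-- The immediate subformula of a negation or an existential quantification. -/
def sub (a : RawFormula) : RawFormula := dec (a.enc / 6)

/-- The bounding variable of a bounded quantification. -/
def bdVar (a : RawFormula) : ℕ := (a.enc / 6).unpair.1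

variable (a b : RawFormula) (i : ℕ)

@[simp] theorem fstSub_and : (and a b).fstSub = a := by
  simp [fstSub, enc, Nat.mul_add_div, dec_enc]
@[simp] theorem sndSub_and : (and a b).sndSub = b := by
  simp [sndSub, enc, Nat.mul_add_div, dec_enc]
@[simp] theorem fstSub_or : (or a b).fstSub = a := by
  simp [fstSub, enc, Nat.mul_add_div, dec_enc]
@[simp] theorem sndSub_or : (or a b).sndSub = b := by
  simp [sndSub, enc, Nat.mul_add_div, dec_enc]
@[simp] theorem sub_neg : (neg a).sub = a := by simp [sub, enc, Nat.mul_add_div, dec_enc]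
@[simp] theorem sub_ex : (ex a).sub = a := by simp [sub, enc, Nat.mul_add_div, dec_enc]
@[simp] theorem bdVar_bdall : (bdall i a).bdVar = i := by simp [bdVar, enc, Nat.mul_add_div]
@[simp] theorem sndSub_bdall : (bdall i a).sndSub = a := by
  simp [sndSub, enc, Nat.mul_add_div, dec_enc]

end RawFormula

section Primrec

variable {α : Type} [Primcodable α]

@[fun_prop]
theorem primrec_dec_comp {f : α → ℕ} (hf : Primrec f) : Primrec fun a => dec (f a) :=
  primrec_dec.comp hf

@[fun_prop]
theorem primrec_encode_list {f : α → List ℕ} (hf : Primrec f) :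
    Primrec fun a => Encodable.encode (f a) := Primrec.encode.comp hf

@[fun_prop]
theorem primrec_pt {f : α → RawFormula} {g : α → List ℕ} (hf : Primrec f) (hg : Primrec g) :
    Primrec fun a => pt (f a) (g a) := by
  unfold pt
  fun_prop

@[fun_prop]
theorem primrec_ptF {f : α → ℕ} (hf : Primrec f) : Primrec fun a => ptF (f a) := by
  unfold ptF
  fun_prop

@[fun_prop]
theorem primrec_ptV {f : α → ℕ} (hf : Primrec f) : Primrec fun a => ptV (f a) := by
  unfold ptV
  fun_prop

variable {f : α → RawFormula}

@[fun_prop]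
theorem primrec_fstSub (hf : Primrec f) : Primrec fun a => (f a).fstSub := by
  unfold fstSub
  fun_prop

@[fun_prop]
theorem primrec_sndSub (hf : Primrec f) : Primrec fun a => (f a).sndSub := by
  unfold sndSub
  fun_prop

@[fun_prop]
theorem primrec_sub (hf : Primrec f) : Primrec fun a => (f a).sub := by
  unfold RawFormula.sub
  fun_prop

@[fun_prop]
theorem primrec_bdVar (hf : Primrec f) : Primrec fun a => (f a).bdVar := by
  unfold bdVar
  fun_prop

@[fun_prop]
theorem primrec_lvl_comp (hf : Primrec f) : Primrec fun a => (f a).lvl := primrec_lvl.comp hf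

theorem primrecPred_mem {g : α → ℕ} {l : α → List ℕ} (hg : Primrec g) (hl : Primrec l) :
    PrimrecPred fun a => g a ∈ l a := by
  have h : PrimrecRel fun x y : ℕ => x = y := Primrec.eq
  exact (h.exists_mem_list.comp hl hg).of_eq fun a => by simp

theorem primrecPred_atomHolds {k x y z : α → ℕ} (hk : Primrec k) (hx : Primrec x)
    (hy : Primrec y) (hz : Primrec z) :
    PrimrecPred fun a => AtomHolds (k a) (x a) (y a) (z a) := by
  refine (((primrecPred_eq hk (.const 0)).and (primrecPred_eq hx hy)).or
    (((primrecPred_eq hk (.const 1)).and (primrecPred_eq hx (.const 0))).or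
    (((primrecPred_eq hk (.const 2)).and (primrecPred_eq (g := y) (f := fun a => x a + 1)
      (by fun_prop) hy)).or
    (((primrecPred_eq hk (.const 3)).and (primrecPred_eq (g := z) (f := fun a => x a + y a)
      (by fun_prop) hz)).or
    (((primrecPred_eq hk (.const 4)).and (primrecPred_eq (g := z) (f := fun a => x a * y a)
      (by fun_prop) hz)).or
    ((primrecPred_le (.const 5) hk).and (primrecPred_le hx hy))))))).of_eq fun a => ?_
  rcases k a with _ | _ | _ | _ | _ | k
  · simp [AtomHolds]
  · simp [AtomHolds]; rfl
  · simp [AtomHolds]; rfl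
  · simp [AtomHolds]; rfl
  · simp [AtomHolds]; rfl
  · simp [AtomHolds]; rfl

end Primrec

/-! ### Partial truth definitions -/

/-- Truth in `ℕ` at a point of level at most `n`. -/
def Tr (n p : ℕ) : Prop := (ptF p).lvl ≤ n ∧ (ptF p).Sat (ptV p)

theorem sig_tr_zero : Sig 0 (Tr 0) := by
  have h₁ : PrimrecPred fun p : ℕ => (ptF p).enc % 6 = 0 :=
    primrecPred_eq (by fun_prop) (.const 0)
  have h₂ : PrimrecPred fun p : ℕ => AtomHolds ((ptF p).enc / 6).unpair.1
      ((ptV p).getD ((ptF p).enc / 6).unpair.2.unpair.1 0)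
      ((ptV p).getD ((ptF p).enc / 6).unpair.2.unpair.2.unpair.1 0)
      ((ptV p).getD ((ptF p).enc / 6).unpair.2.unpair.2.unpair.2 0) :=
    primrecPred_atomHolds (by fun_prop) (by fun_prop) (by fun_prop) (by fun_prop)
  refine (h₁.and h₂).of_eq fun p => ?_
  rw [Tr]
  generalize ptF p = a, ptV p = v
  cases a with
  | atom k i j l => simp [enc, lvl, Sat]; rfl
  | _ => simp [enc, lvl, Nat.add_mod]

/-- The point `p` is true because of the truth of some points of `S` or of the failure of `Tr n`
at some point. -/
def Justified (n : ℕ) (S : List ℕ) (p : ℕ) : Prop :=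
  Tr 0 p ∨
  (ptF p = .and (ptF p).fstSub (ptF p).sndSub ∧
    pt (ptF p).fstSub (ptV p) ∈ S ∧ pt (ptF p).sndSub (ptV p) ∈ S) ∨
  (ptF p = .or (ptF p).fstSub (ptF p).sndSub ∧
    (pt (ptF p).fstSub (ptV p) ∈ S ∨ pt (ptF p).sndSub (ptV p) ∈ S)) ∨
  ((ptF p = .neg (ptF p).sub ∧ (ptF p).sub.lvl ≤ n) ∧ ¬ Tr n (pt (ptF p).sub (ptV p))) ∨
  (ptF p = .ex (ptF p).sub ∧ ∃ x, pt (ptF p).sub (ptV p ++ [x]) ∈ S) ∨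
  (ptF p = .bdall (ptF p).bdVar (ptF p).sndSub ∧
    ∀ x < (ptV p).getD (ptF p).bdVar 0 + 1, pt (ptF p).sndSub (ptV p ++ [x]) ∈ S)

theorem Justified.mono {n p : ℕ} {S S' : List ℕ} (h : Justified n S p) (hS : S ⊆ S') :
    Justified n S' p := by
  rcases h with h | ⟨h, h₁, h₂⟩ | ⟨h, h₁⟩ | h | ⟨h, x, hx⟩ | ⟨h, h₁⟩
  · exact .inl h
  · exact .inr (.inl ⟨h, hS h₁, hS h₂⟩)
  · exact .inr (.inr (.inl ⟨h, h₁.imp (hS ·) (hS ·)⟩))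
  · exact .inr (.inr (.inr (.inl h)))
  · exact .inr (.inr (.inr (.inr (.inl ⟨h, x, hS hx⟩))))
  · exact .inr (.inr (.inr (.inr (.inr ⟨h, fun x hx => hS (h₁ x hx)⟩))))

theorem sat_of_justified {n : ℕ} {S : List ℕ} (hS : ∀ p ∈ S, Justified n S p)
    (a : RawFormula) (v : List ℕ) (h : pt a v ∈ S) : a.Sat v := by
  induction a generalizing v with
  | atom k i j l =>
    have := hS _ h
    simpa [Justified, Tr, lvl] using this
  | and a b iha ihb =>
    have := hS _ h
    simp [Justified, Tr, lvl] at this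
    exact ⟨iha _ this.1, ihb _ this.2⟩
  | or a b iha ihb =>
    have := hS _ h
    simp [Justified, Tr, lvl] at this
    exact this.imp (iha _) (ihb _)
  | neg a =>
    have := hS _ h
    simp [Justified, Tr, lvl] at this
    exact this.2 this.1
  | ex a ih =>
    have := hS _ h
    simp [Justified, Tr, lvl] at this
    exact this.imp fun x => ih _
  | bdall i a ih =>
    have := hS _ h
    simp only [Justified, Tr, lvl, ptF_pt, ptV_pt] at this
    simp only [bdVar_bdall, sndSub_bdall, true_and, reduceCtorEq, false_and, false_or,
      le_zero_iff] at this
    rcases this with ⟨h, -⟩ | this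
    · omega
    · exact fun x hx => ih _ (this x (Nat.lt_succ_of_le (show x ≤ v.getD i 0 from hx)))

theorem exists_justified {n : ℕ} (a : RawFormula) (v : List ℕ) (ha : a.lvl ≤ n + 1)
    (h : a.Sat v) : ∃ S : List ℕ, pt a v ∈ S ∧ ∀ p ∈ S, Justified n S p := by
  have cons (p : ℕ) (S : List ℕ) (hp : Justified n S p) (hS : ∀ q ∈ S, ∃ S' ⊆ S,
      Justified n S' q) : ∀ q ∈ p :: S, Justified n (p :: S) q := fun q hq => by
    rcases List.mem_cons.1 hq with rfl | hq
    · exact hp.mono (List.subset_cons_self _ _)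
    · obtain ⟨S', h, h'⟩ := hS q hq
      exact h'.mono (List.Subset.trans h (List.subset_cons_self _ _))
  induction a generalizing v with
  | atom k i j l => exact ⟨[pt (.atom k i j l) v], by simp, fun p hp => .inl (by
      rw [List.mem_singleton] at hp
      subst hp
      simpa [Tr, lvl] using h)⟩
  | and a b iha ihb =>
    simp only [lvl, max_le_iff] at ha
    obtain ⟨S, h₁, h₂⟩ := iha v ha.2.1 h.1
    obtain ⟨S', h₁', h₂'⟩ := ihb v ha.2.2 h.2
    refine ⟨pt (.and a b) v :: (S ++ S'), by simp, cons _ _ (.inr (.inl ?_)) fun q hq => ?_⟩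
    · simp [h₁, h₁']
    · rcases List.mem_append.1 hq with hq | hq
      · exact ⟨S, List.subset_append_left _ _, h₂ q hq⟩
      · exact ⟨S', List.subset_append_right _ _, h₂' q hq⟩
  | or a b iha ihb =>
    simp only [lvl, max_le_iff] at ha
    rcases h with h | h
    · obtain ⟨S, h₁, h₂⟩ := iha v ha.2.1 h
      exact ⟨pt (.or a b) v :: S, by simp, cons _ _ (.inr (.inr (.inl (by simp [h₁]))))
        fun q hq => ⟨S, List.Subset.refl _, h₂ q hq⟩⟩
    · obtain ⟨S, h₁, h₂⟩ := ihb v ha.2.2 h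
      exact ⟨pt (.or a b) v :: S, by simp, cons _ _ (.inr (.inr (.inl (by simp [h₁]))))
        fun q hq => ⟨S, List.Subset.refl _, h₂ q hq⟩⟩
  | neg a =>
    refine ⟨[pt (.neg a) v], by simp, fun p hp => .inr (.inr (.inr (.inl ?_)))⟩
    rw [List.mem_singleton] at hp
    subst hp
    have ha : a.lvl ≤ n := Nat.le_of_succ_le_succ ha
    have h : ¬ a.Sat v := h
    simp [Tr, ha, h]
  | ex a ih =>
    simp only [lvl, max_le_iff] at ha
    obtain ⟨x, hx⟩ := h
    obtain ⟨S, h₁, h₂⟩ := ih _ ha.2 hx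
    exact ⟨pt (.ex a) v :: S, by simp, cons _ _ (.inr (.inr (.inr (.inr (.inl
      (by simpa using ⟨x, h₁⟩)))))) fun q hq => ⟨S, List.Subset.refl _, h₂ q hq⟩⟩
  | bdall i a ih =>
    simp only [lvl, max_le_iff] at ha
    have h' (x : ℕ) : ∃ S : List ℕ, x < v.getD i 0 + 1 →
        pt a (v ++ [x]) ∈ S ∧ ∀ p ∈ S, Justified n S p := by
      by_cases hx : x < v.getD i 0 + 1
      · obtain ⟨S, hS⟩ := ih _ ha.2 (h x (Nat.le_of_lt_succ hx))
        exact ⟨S, fun _ => hS⟩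
      · exact ⟨[], fun h => (hx h).elim⟩
    choose S hS using h'
    refine ⟨pt (.bdall i a) v :: (List.range (v.getD i 0 + 1)).flatMap S, by simp,
      cons _ _ (.inr (.inr (.inr (.inr (.inr ⟨by simp, fun x hx => ?_⟩))))) fun q hq => ?_⟩
    · rw [ptV_pt, ptF_pt, bdVar_bdall] at hx
      rw [ptV_pt, ptF_pt, sndSub_bdall]
      exact List.mem_flatMap.2 ⟨x, List.mem_range.2 hx, (hS x hx).1⟩
    · obtain ⟨x, hx, hq⟩ := List.mem_flatMap.1 hq
      exact ⟨S x, fun y hy => List.mem_flatMap.2 ⟨x, hx, hy⟩, (hS x (List.mem_range.1 hx)).2 q hq⟩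

theorem sig_justified {n : ℕ} (h : Sig n (Tr n)) :
    Sig (n + 1) fun q : ℕ × ℕ => Justified n (listOf q.1) q.2 := by
  have prim {A : ℕ × ℕ → Prop} (hA : PrimrecPred A) : Sig (n + 1) A := .of_primrecPred hA _
  have mem {f : ℕ × ℕ → ℕ} (hf : Primrec f) : Sig (n + 1) fun q : ℕ × ℕ => f q ∈ listOf q.1 :=
    prim (primrecPred_mem hf (by fun_prop))
  have ptEq {f : ℕ × ℕ → RawFormula} (hf : Primrec f) :
      PrimrecPred fun q : ℕ × ℕ => ptF q.2 = f q := primrecPred_eq (by fun_prop) hf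
  refine .or (prim (PrimrecPred.comp (p := Tr 0) sig_tr_zero Primrec.snd)) (.or (.and
    (prim (ptEq (by fun_prop))) (.and (mem (by fun_prop)) (mem (by fun_prop)))) (.or (.and
    (prim (ptEq (by fun_prop))) (.or (mem (by fun_prop)) (mem (by fun_prop)))) (.or (.and
    (.and (prim (ptEq (by fun_prop))) (prim (primrecPred_le (by fun_prop) (.const n))))
      (Sig.not_succ (h.comp (by fun_prop))))
    (.or (.and (prim (ptEq (by fun_prop))) ?_) (.and (prim (ptEq (by fun_prop))) ?_)))))
  · exact Sig.exists_nat (A := fun r : (ℕ × ℕ) × ℕ =>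
      pt (ptF r.1.2).sub (ptV r.1.2 ++ [r.2]) ∈ listOf r.1.1)
      (.of_primrecPred (primrecPred_mem (by fun_prop) (by fun_prop)) _)
  · exact Sig.forall_lt (A := fun r : (ℕ × ℕ) × ℕ =>
      pt (ptF r.1.2).sndSub (ptV r.1.2 ++ [r.2]) ∈ listOf r.1.1)
      (.of_primrecPred (primrecPred_mem (by fun_prop) (by fun_prop)) _) (by fun_prop)

theorem sig_tr (n : ℕ) : Sig n (Tr n) := by
  induction n with
  | zero => exact sig_tr_zero
  | succ n ih =>
    have hlen : Primrec fun q : ℕ × ℕ => (listOf q.2).length :=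
      Primrec.list_length.comp (by fun_prop)
    have h₁ : Sig (n + 1) fun q : ℕ × ℕ => ∀ i < (listOf q.2).length,
        Justified n (listOf q.2) ((listOf q.2).getD i 0) :=
      Sig.forall_lt (A := fun r : (ℕ × ℕ) × ℕ =>
        Justified n (listOf r.1.2) ((listOf r.1.2).getD r.2 0))
        ((sig_justified ih).comp (f := fun r : (ℕ × ℕ) × ℕ =>
          (r.1.2, (listOf r.1.2).getD r.2 0)) (by fun_prop)) hlen
    have h₂ : Sig (n + 1) fun q : ℕ × ℕ => q.1 ∈ listOf q.2 :=
      .of_primrecPred (primrecPred_mem (by fun_prop) (by fun_prop)) _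
    have h₃ : Sig (n + 1) fun p : ℕ => (ptF p).lvl ≤ n + 1 :=
      .of_primrecPred (primrecPred_le (by fun_prop) (.const _)) _
    refine (h₃.and (Sig.exists_nat (h₂.and h₁))).of_iff fun p => and_congr_right fun hp => ?_
    constructor
    · intro h
      obtain ⟨S, h₁, h₂⟩ := exists_justified _ _ hp h
      refine ⟨Encodable.encode S, by simpa using h₁, fun i hi => ?_⟩
      simp only [listOf_encode] at hi ⊢
      refine h₂ _ ?_
      rw [List.getD_eq_getElem _ _ hi]
      exact List.getElem_mem hi
    · rintro ⟨y, h₁, h₂⟩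
      refine sat_of_justified (n := n) (S := listOf y) (fun q hq => ?_) _ _ (by simpa using h₁)
      obtain ⟨i, hi, rfl⟩ := List.getElem_of_mem hq
      have := h₂ i hi
      rwa [List.getD_eq_getElem _ _ hi] at this

/-! ### A basis theorem for propositional theories -/

/-- A function defined by course-of-values recursion. -/
theorem exists_strong_rec {β : Type} (G : ℕ → (ℕ → β) → β) (d : β) :
    ∃ f : ℕ → β, ∀ n, f n = G n fun i => if i < n then f i else d := by
  refine ⟨fun n => WellFounded.fix Nat.lt_wfRel.wf
    (fun n ih => G n fun i => if h : i < n then ih i h else d) n, fun n => ?_⟩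
  exact (WellFounded.fix_eq ..).trans (congrArg (G n) (funext fun i => by split_ifs <;> rfl))

/-- The valuation `f` satisfies the clause `c`, a list of signed propositional variables. -/
def SatC (f : ℕ → Bool) (c : List (ℕ × Bool)) : Prop := ∃ l ∈ c, f l.1 = l.2

/-- The clause with a given code. -/
def clOf (c : ℕ) : List (ℕ × Bool) := (Encodable.decode₂ (List (ℕ × Bool)) c).getD []

theorem clOf_encode (c : List (ℕ × Bool)) : clOf (Encodable.encode c) = c := by simp [clOf]

theorem primrec_clOf : Primrec clOf :=
  Primrec.option_getD.comp Primrec.decode₂ (Primrec.const [])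

theorem lt_encode_of_mem {c : List (ℕ × Bool)} {l : ℕ × Bool} (h : l ∈ c) :
    l.1 < Encodable.encode c := by
  induction c with
  | nil => simp at h
  | cons x c ih =>
    rw [Encodable.encode_list_cons]
    rcases List.mem_cons.1 h with rfl | h
    · rw [Encodable.encode_prod_val]
      exact Nat.lt_succ_of_le ((Nat.left_le_pair _ _).trans (Nat.left_le_pair _ _))
    · exact Nat.lt_succ_of_le ((ih h).le.trans (Nat.right_le_pair _ _))

theorem lt_of_mem_clOf {c : ℕ} {l : ℕ × Bool} (h : l ∈ clOf c) : l.1 < c := by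
  unfold clOf at h
  cases hd : Encodable.decode₂ (List (ℕ × Bool)) c with
  | none => simp [hd] at h
  | some d =>
    rw [hd] at h
    exact Encodable.mem_decode₂.1 hd ▸ lt_encode_of_mem h

theorem SatC.congr {f g : ℕ → Bool} {c : ℕ} (h : SatC f (clOf c)) (hfg : ∀ i < c, g i = f i) :
    SatC g (clOf c) :=
  let ⟨l, hl, h⟩ := h
  ⟨l, hl, by rw [hfg _ (lt_of_mem_clOf hl), h]⟩

@[fun_prop]
theorem primrec_testBit {α : Type} [Primcodable α] {f g : α → ℕ} (hf : Primrec f)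
    (hg : Primrec g) : Primrec fun a => (f a).testBit (g a) := by
  have h₀ : Primrec fun a => f a / 2 ^ g a % 2 := by fun_prop
  obtain ⟨_, h⟩ := primrecPred_eq h₀ (.const 1)
  exact h.of_eq fun q => by
    rw [Nat.testBit_eq_decide_div_mod_eq]
    congr

theorem primrecPred_satC : PrimrecPred fun q : ℕ × ℕ => SatC q.1.testBit (clOf q.2) := by
  have h : PrimrecRel fun (l : ℕ × Bool) (t : ℕ) => t.testBit l.1 = l.2 :=
    primrecPred_eq (by fun_prop) (by fun_prop)
  exact (h.exists_mem_list.comp (primrec_clOf.comp Primrec.snd) Primrec.fst).of_eq fun _ => Iff.rfl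

section Basis

variable (B : List (ℕ × Bool) × ℕ → Prop)

/-- Some valuation extending the first `L` values of `h` satisfies all clauses with code less
than `b`, as far as they are enumerated with the help of numbers less than `b`. -/
def Ext (h : ℕ → Bool) (L b : ℕ) : Prop :=
  ∃ g : ℕ → Bool, (∀ i < L, g i = h i) ∧ ∀ c < b, ∀ y < b, B (clOf c, y) ∨ SatC g (clOf c)

variable {B}

theorem Ext.congr {h h' : ℕ → Bool} {L b : ℕ} (H : Ext B h L b) (hh : ∀ i < L, h' i = h i) :
    Ext B h' L b :=
  let ⟨g, h₁, h₂⟩ := H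
  ⟨g, fun i hi => by rw [h₁ i hi, hh i hi], h₂⟩

theorem sig_ext {n : ℕ} (hB : Sig n B) :
    Sig n fun q : (ℕ × ℕ) × ℕ => Ext B q.1.1.testBit q.1.2 q.2 := by
  have h₁ : Sig n fun q : ((ℕ × ℕ) × ℕ) × ℕ => ∀ i < q.1.1.2,
      q.2.testBit i = q.1.1.1.testBit i :=
    Sig.forall_lt (A := fun r : (((ℕ × ℕ) × ℕ) × ℕ) × ℕ =>
      r.1.2.testBit r.2 = r.1.1.1.1.testBit r.2)
      (.of_primrecPred (primrecPred_eq
        (by fun_prop)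
        (by fun_prop)) n) (by fun_prop)
  have h₂ : Sig n fun q : ((ℕ × ℕ) × ℕ) × ℕ => ∀ c < q.1.2, ∀ y < q.1.2,
      B (clOf c, y) ∨ SatC q.2.testBit (clOf c) := by
    refine Sig.forall_lt (A := fun r : (((ℕ × ℕ) × ℕ) × ℕ) × ℕ => ∀ y < r.1.1.2,
      B (clOf r.2, y) ∨ SatC r.1.2.testBit (clOf r.2))
      (Sig.forall_lt (A := fun r : ((((ℕ × ℕ) × ℕ) × ℕ) × ℕ) × ℕ =>
        B (clOf r.1.2, r.2) ∨ SatC r.1.1.2.testBit (clOf r.1.2)) (.or (hB.comp ?_)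
          (.of_primrecPred (primrecPred_satC.comp (f := fun r : ((((ℕ × ℕ) × ℕ) × ℕ) × ℕ) × ℕ =>
            (r.1.1.2, r.1.2)) (by fun_prop)) n)) (by fun_prop)) (by fun_prop)
    exact (primrec_clOf.comp (Primrec.snd.comp Primrec.fst)).pair Primrec.snd
  refine (Sig.exists_lt (h₁.and h₂) (f := fun q : (ℕ × ℕ) × ℕ => 2 ^ (q.1.2 + q.2))
    (by fun_prop)).of_iff fun q => ?_
  constructor
  · rintro ⟨g, h₁, h₂⟩
    have hbit (i : ℕ) (hi : i < q.1.2 + q.2) :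
        (Nat.ofBits fun i : Fin (q.1.2 + q.2) => g i).testBit i = g i :=
      Nat.testBit_ofBits_lt _ _ hi
    exact ⟨_, Nat.ofBits_lt_two_pow fun i : Fin (q.1.2 + q.2) => g i,
      fun i hi => by rw [← h₁ i hi]; exact hbit i (Nat.lt_add_right _ hi),
      fun c hc y hy => (h₂ c hc y hy).imp_right fun h => h.congr fun i hi => hbit i (by
        simp only at hc; omega)⟩
  · rintro ⟨t, -, h₁, h₂⟩
    exact ⟨t.testBit, h₁, h₂⟩

/-- Every satisfiable `Σₙ₊₁`-set of clauses is satisfied by a `Σₙ₊₂`-valuation. -/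
theorem exists_sig_valuation {n : ℕ} {Cl : List (ℕ × Bool) → Prop} (hCl : Sig (n + 1) Cl)
    (hsat : ∃ g, ∀ c, Cl c → SatC g c) :
    ∃ f : ℕ → Bool, (∀ c, Cl c → SatC f c) ∧ Sig (n + 2) fun p => f p = true := by
  classical
  obtain ⟨B, hB, hCl⟩ := hCl
  obtain ⟨g₀, hg₀⟩ := hsat
  have hE : Sig (n + 1) fun q : ℕ × ℕ => ¬ ∀ b, Ext B q.1.testBit q.2 b :=
    ⟨_, sig_ext hB, fun q => by simp⟩
  obtain ⟨f, hf⟩ := exists_strong_rec (fun j h => !decide (∀ b, Ext B h (j + 1) b)) false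
  have hff (j : ℕ) (h : ∀ b, Ext B (fun i => if i < j then f i else false) (j + 1) b) :
      f j = false := (hf j).trans (by rw [decide_eq_true h]; rfl)
  have hft (j : ℕ) (h : ¬ ∀ b, Ext B (fun i => if i < j then f i else false) (j + 1) b) :
      f j = true := (hf j).trans (by rw [decide_eq_false h]; rfl)
  have hext (L b : ℕ) : Ext B f L b := by
    induction L generalizing b with
    | zero =>
      refine ⟨g₀, fun i hi => (Nat.not_lt_zero i hi).elim, fun c _ y _ => ?_⟩
      by_contra hcon
      push Not at hcon
      exact hcon.2 (hg₀ _ ((hCl _).2 ⟨y, hcon.1⟩))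
    | succ L ih =>
      by_cases hL : ∀ b, Ext B (fun i => if i < L then f i else false) (L + 1) b
      · refine (hL b).congr fun i hi => ?_
        rcases Nat.lt_succ_iff_lt_or_eq.1 hi with hi | rfl
        · simp [hi]
        · simp [hff _ hL]
      · have hfL : f L = true := hft L hL
        push Not at hL
        obtain ⟨b', hb'⟩ := hL
        obtain ⟨g, h₁, h₂⟩ := ih (max b b')
        refine ⟨g, fun i hi => ?_, fun c hc y hy => h₂ c (by omega) y (by omega)⟩
        rcases Nat.lt_succ_iff_lt_or_eq.1 hi with hi | rfl
        · exact h₁ i hi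
        · rw [hfL]
          by_contra hg
          refine hb' ⟨g, fun j hj => ?_, fun c hc y hy => h₂ c (by omega) y (by omega)⟩
          rcases Nat.lt_succ_iff_lt_or_eq.1 hj with hj | rfl
          · simp [hj, h₁ j hj]
          · simpa using hg
  refine ⟨f, fun c hc => ?_, ?_⟩
  · obtain ⟨y, hy⟩ := (hCl c).1 hc
    obtain ⟨g, h₁, h₂⟩ := hext (Encodable.encode c) (max (Encodable.encode c) y + 1)
    have := h₂ (Encodable.encode c) (by omega) y (by omega)
    rw [clOf_encode] at this
    obtain ⟨l, hl, h⟩ := this.resolve_left hy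
    exact ⟨l, hl, by rw [← h₁ _ (lt_encode_of_mem hl), h]⟩
  · have hbit (b : Bool) : Sig (n + 2) fun r : (ℕ × ℕ) × ℕ => r.1.2.testBit r.2 = b :=
      .of_primrecPred (primrecPred_eq (by fun_prop) (.const b)) _
    have hE' : Sig (n + 1) fun r : (ℕ × ℕ) × ℕ =>
        ¬ ∀ b, Ext B (r.1.2 % 2 ^ r.2).testBit (r.2 + 1) b :=
      hE.comp (f := fun r : (ℕ × ℕ) × ℕ => (r.1.2 % 2 ^ r.2, r.2 + 1)) (by fun_prop)
    have hmain : Sig (n + 2) fun q : ℕ × ℕ => ∀ j < q.1 + 1,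
        (q.2.testBit j = false ∧ ¬ ¬ ∀ b, Ext B (q.2 % 2 ^ j).testBit (j + 1) b) ∨
        (q.2.testBit j = true ∧ ¬ ∀ b, Ext B (q.2 % 2 ^ j).testBit (j + 1) b) :=
      Sig.forall_lt (f := fun q : ℕ × ℕ => q.1 + 1)
        (((hbit false).and hE'.not_succ).or ((hbit true).and hE'.succ)) (by fun_prop)
    have htop : Sig (n + 2) fun q : ℕ × ℕ => q.2.testBit q.1 = true :=
      .of_primrecPred (primrecPred_eq (by fun_prop) (.const true)) _
    refine (Sig.exists_lt (f := fun p : ℕ => 2 ^ (p + 1)) (htop.and hmain)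
      (by fun_prop)).of_iff fun p => ?_
    constructor
    · intro hp
      have hbits (i : ℕ) (hi : i < p + 1) :
          (Nat.ofBits fun i : Fin (p + 1) => f i).testBit i = f i :=
        Nat.testBit_ofBits_lt _ _ hi
      refine ⟨_, Nat.ofBits_lt_two_pow fun i : Fin (p + 1) => f i, ?_, fun j hj => ?_⟩
      · exact (hbits p (by omega)).trans hp
      · have : ((Nat.ofBits fun i : Fin (p + 1) => f i) % 2 ^ j).testBit =
            fun i => if i < j then f i else false := funext fun i => by
          rw [Nat.testBit_mod_two_pow]
          by_cases hij : i < j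
          · simp only [hij, decide_true, Bool.true_and, if_true]
            exact hbits i (by simp only at hj; omega)
          · simp [hij]
        simp only at hj ⊢
        rw [this, hbits j hj]
        by_cases hj : ∀ b, Ext B (fun i => if i < j then f i else false) (j + 1) b
        · exact .inl ⟨hff j hj, not_not_intro hj⟩
        · exact .inr ⟨hft j hj, hj⟩
    · rintro ⟨s, -, h₁, h₂⟩
      have key : ∀ j < p + 1, s.testBit j = f j := fun j => by
        induction j using Nat.strong_induction_on with
        | _ j ih =>
          intro hj
          have : (s % 2 ^ j).testBit = fun i => if i < j then f i else false :=
            funext fun i => by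
              rw [Nat.testBit_mod_two_pow]
              by_cases hij : i < j
              · simp only [hij, decide_true, Bool.true_and, if_true]
                exact ih i hij (by omega)
              · simp [hij]
          have h₂ := h₂ j hj
          simp only at h₂
          rw [this] at h₂
          rcases h₂ with h | h
          · rw [h.1, hff j (not_not.1 h.2)]
          · rw [h.1, hft j h.2]
      rw [← key p (by omega)]
      exact h₁

end Basis

/-! ### Henkin clauses -/

/-- The point for an atom with three parameters. -/
def atomPt (k x y z : ℕ) : ℕ := pt (atom k 0 1 2) [x, y, z]

@[fun_prop]
theorem primrec_atomPt {α : Type} [Primcodable α] {k x y z : α → ℕ} (hk : Primrec k)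
    (hx : Primrec x) (hy : Primrec y) (hz : Primrec z) :
    Primrec fun a => atomPt (k a) (x a) (y a) (z a) := by
  unfold atomPt
  fun_prop

/-- The clauses saying that a valuation of the points is the theory of a structure in which every
number names an element. The number `0` names zero, and the witnesses for a quantified formula
are named by the point of that formula. -/
inductive Henkin : List (ℕ × Bool) → Prop
  | and_intro (a b v) : Henkin [(pt (and a b) v, true), (pt a v, false), (pt b v, false)]
  | and_left (a b v) : Henkin [(pt (and a b) v, false), (pt a v, true)]
  | and_right (a b v) : Henkin [(pt (and a b) v, false), (pt b v, true)]
  | or_elim (a b v) : Henkin [(pt (or a b) v, false), (pt a v, true), (pt b v, true)]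
  | or_left (a b v) : Henkin [(pt (or a b) v, true), (pt a v, false)]
  | or_right (a b v) : Henkin [(pt (or a b) v, true), (pt b v, false)]
  | neg_intro (a v) : Henkin [(pt (neg a) v, true), (pt a v, true)]
  | neg_elim (a v) : Henkin [(pt (neg a) v, false), (pt a v, false)]
  | ex_intro (a v x) : Henkin [(pt (ex a) v, true), (pt a (v ++ [x]), false)]
  | ex_elim (a v) : Henkin [(pt (ex a) v, false), (pt a (v ++ [pt (ex a) v]), true)]
  | bdall_elim (i a v x) : Henkin [(pt (bdall i a) v, false),
      (atomPt 5 x (v.getD i 0) 0, false), (pt a (v ++ [x]), true)]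
  | bdall_le (i a v) : Henkin [(pt (bdall i a) v, true),
      (atomPt 5 (pt (bdall i a) v) (v.getD i 0) 0, true)]
  | bdall_intro (i a v) : Henkin [(pt (bdall i a) v, true),
      (pt a (v ++ [pt (bdall i a) v]), false)]
  | atom_elim (k i j l v) : Henkin [(pt (atom k i j l) v, false),
      (atomPt k (v.getD i 0) (v.getD j 0) (v.getD l 0), true)]
  | atom_intro (k i j l v) : Henkin [(pt (atom k i j l) v, true),
      (atomPt k (v.getD i 0) (v.getD j 0) (v.getD l 0), false)]
  | refl (x) : Henkin [(atomPt 0 x x 0, true)]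
  | congr (k x y z x' y' z') : Henkin [(atomPt k x y z, false), (atomPt 0 x x' 0, false),
      (atomPt 0 y y' 0, false), (atomPt 0 z z' 0, false), (atomPt k x' y' z', true)]
  | irrel_eq (x y z z') : Henkin [(atomPt 0 x y z, false), (atomPt 0 x y z', true)]
  | irrel_zero (x y z y' z') : Henkin [(atomPt 1 x y z, false), (atomPt 1 x y' z', true)]
  | irrel_succ (x y z z') : Henkin [(atomPt 2 x y z, false), (atomPt 2 x y z', true)]
  | irrel_le (k k' x y z z') :
      Henkin [(atomPt (k + 5) x y z, false), (atomPt (k' + 5) x y z', true)]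
  | zero : Henkin [(atomPt 1 0 0 0, true)]
  | zero_unique (x) : Henkin [(atomPt 1 x 0 0, false), (atomPt 0 x 0 0, true)]
  | succ_unique (x y z) :
      Henkin [(atomPt 2 x y 0, false), (atomPt 2 x z 0, false), (atomPt 0 y z 0, true)]
  | add_unique (x y z z') :
      Henkin [(atomPt 3 x y z, false), (atomPt 3 x y z', false), (atomPt 0 z z' 0, true)]
  | mul_unique (x y z z') :
      Henkin [(atomPt 4 x y z, false), (atomPt 4 x y z', false), (atomPt 0 z z' 0, true)]
  | succ_total (x) : Henkin [(pt (ex (atom 2 0 1 1)) [x], true)]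
  | add_total (x y) : Henkin [(pt (ex (atom 3 0 1 2)) [x, y], true)]
  | mul_total (x y) : Henkin [(pt (ex (atom 4 0 1 2)) [x, y], true)]

theorem sig_exists_mem {α β : Type} [Primcodable α] [Primcodable β] {F : α → List β}
    (hF : Primrec F) (n : ℕ) : Sig (n + 1) fun c => ∃ a, c ∈ F a := by
  have h₁ : PrimrecRel fun x y : β => x = y := Primrec.eq
  have h₂ : PrimrecPred fun q : β × ℕ =>
      ∃ c ∈ ((Encodable.decode (α := α) q.2).map F).getD [], c = q.1 :=
    h₁.exists_mem_list.comp (Primrec.option_getD.comp (Primrec.option_map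
      (Primrec.decode.comp Primrec.snd) (hF.comp Primrec.snd).to₂) (Primrec.const []))
      Primrec.fst
  refine (Sig.of_primrecPred h₂ (n + 1)).exists_nat.of_iff fun c => ⟨?_, ?_⟩
  · rintro ⟨a, ha⟩
    exact ⟨Encodable.encode a, c, by simpa using ha, rfl⟩
  · rintro ⟨m, c, hm, rfl⟩
    dsimp only at hm
    cases hd : Encodable.decode (α := α) m with
    | none => simp [hd] at hm
    | some a => exact ⟨a, by simpa [hd] using hm⟩

theorem sig_henkin (n : ℕ) : Sig (n + 1) Henkin := by
  let F₁ (a b : RawFormula) (v : List ℕ) : List (List (ℕ × Bool)) :=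
    [ [(pt (and a b) v, true), (pt a v, false), (pt b v, false)],
      [(pt (and a b) v, false), (pt a v, true)],
      [(pt (and a b) v, false), (pt b v, true)],
      [(pt (or a b) v, false), (pt a v, true), (pt b v, true)],
      [(pt (or a b) v, true), (pt a v, false)],
      [(pt (or a b) v, true), (pt b v, false)],
      [(pt (neg a) v, true), (pt a v, true)],
      [(pt (neg a) v, false), (pt a v, false)],
      [(pt (ex a) v, false), (pt a (v ++ [pt (ex a) v]), true)] ]
  let F₂ (a : RawFormula) (v : List ℕ) (x i : ℕ) : List (List (ℕ × Bool)) :=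
    [ [(pt (ex a) v, true), (pt a (v ++ [x]), false)],
      [(pt (bdall i a) v, false), (atomPt 5 x (v.getD i 0) 0, false), (pt a (v ++ [x]), true)],
      [(pt (bdall i a) v, true), (atomPt 5 (pt (bdall i a) v) (v.getD i 0) 0, true)],
      [(pt (bdall i a) v, true), (pt a (v ++ [pt (bdall i a) v]), false)] ]
  let F₃ (k i j l : ℕ) (v : List ℕ) : List (List (ℕ × Bool)) :=
    [ [(pt (atom k i j l) v, false),
        (atomPt k (v.getD i 0) (v.getD j 0) (v.getD l 0), true)],
      [(pt (atom k i j l) v, true),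
        (atomPt k (v.getD i 0) (v.getD j 0) (v.getD l 0), false)] ]
  let F₄ (k k' x y z x' y' z' : ℕ) : List (List (ℕ × Bool)) :=
    [ [(atomPt 0 x x 0, true)],
      [(atomPt k x y z, false), (atomPt 0 x x' 0, false), (atomPt 0 y y' 0, false),
        (atomPt 0 z z' 0, false), (atomPt k x' y' z', true)],
      [(atomPt 0 x y z, false), (atomPt 0 x y z', true)],
      [(atomPt 1 x y z, false), (atomPt 1 x y' z', true)],
      [(atomPt 2 x y z, false), (atomPt 2 x y z', true)],
      [(atomPt (k + 5) x y z, false), (atomPt (k' + 5) x y z', true)],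
      [(atomPt 1 0 0 0, true)],
      [(atomPt 1 x 0 0, false), (atomPt 0 x 0 0, true)],
      [(atomPt 2 x y 0, false), (atomPt 2 x z 0, false), (atomPt 0 y z 0, true)],
      [(atomPt 3 x y z, false), (atomPt 3 x y z', false), (atomPt 0 z z' 0, true)],
      [(atomPt 4 x y z, false), (atomPt 4 x y z', false), (atomPt 0 z z' 0, true)],
      [(pt (ex (atom 2 0 1 1)) [x], true)],
      [(pt (ex (atom 3 0 1 2)) [x, y], true)],
      [(pt (ex (atom 4 0 1 2)) [x, y], true)] ]
  have h₁ : Primrec fun q : (RawFormula × RawFormula) × List ℕ => F₁ q.1.1 q.1.2 q.2 := by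
    dsimp only [F₁]
    fun_prop
  have h₂ : Primrec fun q : RawFormula × List ℕ × ℕ × ℕ => F₂ q.1 q.2.1 q.2.2.1 q.2.2.2 := by
    dsimp only [F₂]
    fun_prop
  have h₃ : Primrec fun q : (ℕ × ℕ × ℕ × ℕ) × List ℕ =>
      F₃ q.1.1 q.1.2.1 q.1.2.2.1 q.1.2.2.2 q.2 := by
    dsimp only [F₃]
    fun_prop
  have h₄ : Primrec fun q : (ℕ × ℕ) × (ℕ × ℕ × ℕ) × (ℕ × ℕ × ℕ) =>
      F₄ q.1.1 q.1.2 q.2.1.1 q.2.1.2.1 q.2.1.2.2 q.2.2.1 q.2.2.2.1 q.2.2.2.2 := by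
    dsimp only [F₄]
    fun_prop
  refine (((sig_exists_mem h₁ n).or (sig_exists_mem h₂ n)).or
    ((sig_exists_mem h₃ n).or (sig_exists_mem h₄ n))).of_iff fun c => ⟨fun h => ?_, ?_⟩
  · cases h with
    | and_intro a b v | and_left a b v | and_right a b v
    | or_elim a b v | or_left a b v | or_right a b v =>
      exact .inl (.inl ⟨((a, b), v), by simp [F₁]⟩)
    | neg_intro a v | neg_elim a v | ex_elim a v =>
      exact .inl (.inl ⟨((a, a), v), by simp [F₁]⟩)
    | ex_intro a v x => exact .inl (.inr ⟨(a, v, x, 0), by simp [F₂]⟩)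
    | bdall_elim i a v x => exact .inl (.inr ⟨(a, v, x, i), by simp [F₂]⟩)
    | bdall_le i a v | bdall_intro i a v =>
      exact .inl (.inr ⟨(a, v, 0, i), by simp [F₂]⟩)
    | atom_elim k i j l v | atom_intro k i j l v =>
      exact .inr (.inl ⟨((k, i, j, l), v), by simp [F₃]⟩)
    | zero => exact .inr (.inr ⟨((0, 0), (0, 0, 0), (0, 0, 0)), by simp [F₄]⟩)
    | refl x | zero_unique x | succ_total x =>
      exact .inr (.inr ⟨((0, 0), (x, 0, 0), (0, 0, 0)), by simp [F₄]⟩)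
    | add_total x y | mul_total x y =>
      exact .inr (.inr ⟨((0, 0), (x, y, 0), (0, 0, 0)), by simp [F₄]⟩)
    | congr k x y z x' y' z' =>
      exact .inr (.inr ⟨((k, 0), (x, y, z), (x', y', z')), by simp [F₄]⟩)
    | irrel_zero x y z y' z' =>
      exact .inr (.inr ⟨((0, 0), (x, y, z), (0, y', z')), by simp [F₄]⟩)
    | irrel_le k k' x y z z' =>
      exact .inr (.inr ⟨((k, k'), (x, y, z), (0, 0, z')), by simp [F₄]⟩)
    | succ_unique x y z =>
      exact .inr (.inr ⟨((0, 0), (x, y, z), (0, 0, 0)), by simp [F₄]⟩)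
    | irrel_eq x y z z' | irrel_succ x y z z' | add_unique x y z z' | mul_unique x y z z' =>
      exact .inr (.inr ⟨((0, 0), (x, y, z), (0, 0, z')), by simp [F₄]⟩)
  · rintro ((⟨⟨⟨a, b⟩, v⟩, h⟩ | ⟨⟨a, v, x, i⟩, h⟩) |
      (⟨⟨⟨k, i, j, l⟩, v⟩, h⟩ | ⟨⟨⟨k, k'⟩, ⟨x, y, z⟩, ⟨x', y', z'⟩⟩, h⟩))
    · simp only [F₁, List.mem_cons, List.not_mem_nil, or_false] at h
      rcases h with rfl | rfl | rfl | rfl | rfl | rfl | rfl | rfl | rfl <;> constructor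
    · simp only [F₂, List.mem_cons, List.not_mem_nil, or_false] at h
      rcases h with rfl | rfl | rfl | rfl <;> constructor
    · simp only [F₃, List.mem_cons, List.not_mem_nil, or_false] at h
      rcases h with rfl | rfl <;> constructor
    · simp only [F₄, List.mem_cons, List.not_mem_nil, or_false] at h
      rcases h with rfl | rfl | rfl | rfl | rfl | rfl | rfl | rfl | rfl | rfl | rfl | rfl | rfl | rfl
      · exact .refl ..
      · exact .congr ..
      · exact .irrel_eq ..
      · exact .irrel_zero ..
      · exact .irrel_succ ..
      · exact .irrel_le ..
      · exact .zero
      · exact .zero_unique ..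
      · exact .succ_unique ..
      · exact .add_unique ..
      · exact .mul_unique ..
      · exact .succ_total ..
      · exact .add_total ..
      · exact .mul_total ..

@[simp] theorem not_satC_nil (f : ℕ → Bool) : ¬ SatC f [] := by simp [SatC]

@[simp] theorem satC_cons (f : ℕ → Bool) (p : ℕ) (b : Bool) (c : List (ℕ × Bool)) :
    SatC f ((p, b) :: c) ↔ f p = b ∨ SatC f c := by simp [SatC]

section Names

variable {M : Type} [LA.Structure M]

theorem get_map {ρ : ℕ → M} (h : ρ 0 = zeroM M) (v : List ℕ) (i : ℕ) :
    get (v.map ρ) i = ρ (v.getD i 0) := by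
  rw [RawFormula.get, ← h, List.getD_map]

theorem sat_atomPt {ρ : ℕ → M} (k x y z : ℕ) :
    (atom k 0 1 2).Sat ([x, y, z].map ρ) ↔ AtomHolds k (ρ x) (ρ y) (ρ z) := by
  simp [Sat, RawFormula.get]

end Names

theorem lt_pt_of_mem {a : RawFormula} {v : List ℕ} {x : ℕ} (h : x ∈ v) : x < pt a v := by
  refine lt_of_lt_of_le ?_ (Nat.right_le_pair _ _)
  induction v with
  | nil => simp at h
  | cons y v ih =>
    rw [Encodable.encode_list_cons]
    rcases List.mem_cons.1 h with rfl | h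
    · exact Nat.lt_succ_of_le (Nat.left_le_pair _ _)
    · exact Nat.lt_succ_of_le ((ih h).le.trans (Nat.right_le_pair _ _))

/-- The number `x` witnesses the truth of an existential quantification or the falsity of a
bounded universal quantification. -/
def Witness : RawFormula → List ℕ → ℕ → Prop
  | ex a, v, x => a.Sat (v ++ [x])
  | bdall i a, v, x => leM x (get v i) ∧ ¬ a.Sat (v ++ [x])
  | _, _, x => x = 0

/-- There is an interpretation in `ℕ` of the numbers as names which interprets the names of
the witnesses correctly. -/
theorem exists_names : ∃ ρ : ℕ → ℕ, ρ 0 = 0 ∧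
    ∀ a v x, Witness a (v.map ρ) x → Witness a (v.map ρ) (ρ (pt a v)) := by
  classical
  obtain ⟨ρ, hρ⟩ := exists_strong_rec
    (fun p h => Classical.epsilon (Witness (ptF p) ((ptV p).map h))) 0
  have hρ' (p : ℕ) : ρ p = Classical.epsilon (Witness (ptF p) ((ptV p).map ρ)) := by
    rw [hρ]
    congr 2
    refine List.map_congr_left fun x hx => if_pos ?_
    have := lt_pt_of_mem (a := ptF p) hx
    rwa [pt_ptF_ptV] at this
  refine ⟨ρ, ?_, fun a v x hx => ?_⟩
  · have h0 : ptF 0 = atom 0 0 0 0 := by simp [ptF, dec]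
    have : Witness (ptF 0) ((ptV 0).map ρ) (ρ 0) := by
      conv_rhs => rw [hρ']
      exact Classical.epsilon_spec (p := Witness (ptF 0) ((ptV 0).map ρ)) ⟨0, by rw [h0]; rfl⟩
    rw [h0] at this
    exact this
  · have : ρ (pt a v) = Classical.epsilon (Witness a (v.map ρ)) := by simp [hρ' (pt a v)]
    rw [this]
    exact Classical.epsilon_spec ⟨x, hx⟩

/-- The Henkin clauses are satisfied by a valuation that agrees on sentences with truth
in `ℕ`. -/
theorem exists_valuation : ∃ g : ℕ → Bool, (∀ c, Henkin c → SatC g c) ∧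
    ∀ e : RawFormula, g (pt e []) = true ↔ e.Sat ([] : List ℕ) := by
  classical
  obtain ⟨ρ, h0, hρ⟩ := exists_names
  have h0' : ρ 0 = zeroM ℕ := h0
  refine ⟨fun p => decide ((ptF p).Sat ((ptV p).map ρ)), fun c hc => ?_, fun e => by simp⟩
  have hat (k x y z : ℕ) : (ptF (atomPt k x y z)).Sat ((ptV (atomPt k x y z)).map ρ) ↔
      AtomHolds k (ρ x) (ρ y) (ρ z) := by
    simp only [atomPt, ptF_pt, ptV_pt, sat_atomPt]
  have hz (x : ℕ) : x = zeroM ℕ ↔ x = 0 := Iff.rfl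
  cases hc <;> simp only [satC_cons, not_satC_nil, or_false, decide_eq_true_iff,
    decide_eq_false_iff_not, hat, ptF_pt, ptV_pt, Sat, List.map_append, List.map_cons,
    List.map_nil, get_map h0', AtomHolds, hz, h0]
  case ex_elim a v =>
    rw [← imp_iff_not_or]
    exact fun ⟨x, hx⟩ => hρ (ex a) v x hx
  case bdall_le i a v =>
    rw [or_iff_not_imp_left]
    push Not
    rintro ⟨x, hx⟩
    have := (hρ (bdall i a) v x (by rwa [Witness, get_map h0'])).1
    rwa [get_map h0'] at this
  case bdall_intro i a v =>
    rw [or_iff_not_imp_left]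
    push Not
    rintro ⟨x, hx⟩
    exact (hρ (bdall i a) v x (by rwa [Witness, get_map h0'])).2
  case succ_total x => exact ⟨succM (ρ x), rfl⟩
  case add_total x y => exact ⟨addM (ρ x) (ρ y), rfl⟩
  case mul_total x y => exact ⟨mulM (ρ x) (ρ y), rfl⟩
  all_goals grind

/-! ### The Henkin model -/

section Model

/-- The structure on a type `M` given by an interpretation of the symbols. -/
@[reducible] def mkStructure {M : Type} (z : M) (s : M → M) (p t : M → M → M) (r : M → M → Prop) :
    LA.Structure M where
  funMap {_} f := match f with
    | ArithFunc.zero => fun _ => z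
    | ArithFunc.succ => fun v => s (v 0)
    | ArithFunc.add => fun v => p (v 0) (v 1)
    | ArithFunc.mul => fun v => t (v 0) (v 1)
  RelMap {_} q := match q with
    | ArithRel.le => fun v => r (v 0) (v 1)

/-- A valuation satisfying the Henkin clauses describes a structure. -/
theorem exists_model {f : ℕ → Bool} (hf : ∀ c, Henkin c → SatC f c) :
    ∃ (M : Type) (_ : LA.Structure M), Nonempty M ∧
      ∀ e : RawFormula, f (pt e []) = true ↔ e.Sat ([] : List M) := by
  have hrefl (x : ℕ) : f (atomPt 0 x x 0) = true := by simpa using hf _ (.refl x)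
  have hcongr {k x y z x' y' z' : ℕ} (h : f (atomPt k x y z) = true)
      (hx : f (atomPt 0 x x' 0) = true) (hy : f (atomPt 0 y y' 0) = true)
      (hz : f (atomPt 0 z z' 0) = true) : f (atomPt k x' y' z') = true := by
    have := hf _ (.congr k x y z x' y' z')
    simp only [satC_cons, not_satC_nil] at this
    grind
  have hsymm {x y : ℕ} (h : f (atomPt 0 x y 0) = true) : f (atomPt 0 y x 0) = true :=
    hcongr (hrefl x) h (hrefl x) (hrefl 0)
  let s : Setoid ℕ := ⟨fun x y => f (atomPt 0 x y 0) = true, hrefl, hsymm,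
    fun h h' => hcongr h (hrefl _) h' (hrefl 0)⟩
  let mk : ℕ → Quotient s := Quotient.mk s
  have hmk {x y : ℕ} : mk x = mk y ↔ f (atomPt 0 x y 0) = true := Quotient.eq
  have hout (m : Quotient s) : mk m.out = m := m.out_eq
  let inst : LA.Structure (Quotient s) := mkStructure (mk 0)
    (fun x => mk (pt (ex (atom 2 0 1 1)) [x.out]))
    (fun x y => mk (pt (ex (atom 3 0 1 2)) [x.out, y.out]))
    (fun x y => mk (pt (ex (atom 4 0 1 2)) [x.out, y.out]))
    (fun x y => f (atomPt 5 x.out y.out 0) = true)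
  have h0 : mk 0 = zeroM (Quotient s) := rfl
  have hwit (a : RawFormula) (v : List ℕ) (h : f (pt (ex a) v) = true) :
      f (pt a (v ++ [pt (ex a) v])) = true := by
    have := hf _ (.ex_elim a v)
    simp only [satC_cons, not_satC_nil] at this
    grind
  have hatom (k i j l : ℕ) (v : List ℕ) : f (pt (atom k i j l) v) = true ↔
      f (atomPt k (v.getD i 0) (v.getD j 0) (v.getD l 0)) = true := by
    have h₁ := hf _ (.atom_elim k i j l v)
    have h₂ := hf _ (.atom_intro k i j l v)
    simp only [satC_cons, not_satC_nil] at h₁ h₂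
    grind
  have hsucc (x : ℕ) : f (atomPt 2 x (pt (ex (atom 2 0 1 1)) [x])
      (pt (ex (atom 2 0 1 1)) [x])) = true := by
    have := hwit _ _ (by simpa using hf _ (.succ_total x))
    rwa [hatom] at this
  have hadd (x y : ℕ) : f (atomPt 3 x y (pt (ex (atom 3 0 1 2)) [x, y])) = true := by
    have := hwit _ _ (by simpa using hf _ (.add_total x y))
    rwa [hatom] at this
  have hmul (x y : ℕ) : f (atomPt 4 x y (pt (ex (atom 4 0 1 2)) [x, y])) = true := by
    have := hwit _ _ (by simpa using hf _ (.mul_total x y))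
    rwa [hatom] at this
  have hirrel_eq {x y z z' : ℕ} (h : f (atomPt 0 x y z) = true) :
      f (atomPt 0 x y z') = true := by
    have := hf _ (.irrel_eq x y z z')
    simp only [satC_cons, not_satC_nil] at this
    grind
  have hirrel_succ {x y z z' : ℕ} (h : f (atomPt 2 x y z) = true) :
      f (atomPt 2 x y z') = true := by
    have := hf _ (.irrel_succ x y z z')
    simp only [satC_cons, not_satC_nil] at this
    grind
  have key (k x y z : ℕ) : AtomHolds k (mk x) (mk y) (mk z) ↔ f (atomPt k x y z) = true := by
    have ho (x : ℕ) : f (atomPt 0 (mk x).out x 0) = true := hmk.1 (hout _)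
    rcases k with _ | _ | _ | _ | _ | k
    · exact hmk.trans ⟨hirrel_eq, hirrel_eq⟩
    · refine hmk.trans ⟨fun h => ?_, fun h => ?_⟩
      · have h₁ := hf _ (.irrel_zero x 0 0 y z)
        have h₂ := hcongr (by simpa using hf _ .zero) (hsymm h) (hrefl 0) (hrefl 0)
        simp only [satC_cons, not_satC_nil] at h₁
        grind
      · have h₁ := hf _ (.irrel_zero x y z 0 0)
        have h₂ := hf _ (.zero_unique x)
        simp only [satC_cons, not_satC_nil] at h₁ h₂
        grind
    · refine hmk.trans ⟨fun h => ?_, fun h => ?_⟩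
      · exact hirrel_succ (hcongr (hsucc _) (ho x) h (hrefl _))
      · have h₁ := hf _ (.succ_unique x (pt (ex (atom 2 0 1 1)) [(mk x).out]) y)
        have h₂ := hirrel_succ (z' := 0) h
        have h₃ := hirrel_succ (z' := 0)
          (hcongr (hsucc _) (ho x) (hrefl _) (hrefl _))
        simp only [satC_cons, not_satC_nil] at h₁
        change f (atomPt 0 (pt (ex (atom 2 0 1 1)) [(mk x).out]) y 0) = true
        grind
    · refine hmk.trans ⟨fun h => hcongr (hadd _ _) (ho x) (ho y) h, fun h => ?_⟩
      have h₁ := hf _ (.add_unique x y (pt (ex (atom 3 0 1 2)) [(mk x).out, (mk y).out]) z)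
      have h₂ := hcongr (hadd _ _) (ho x) (ho y) (hrefl _)
      simp only [satC_cons, not_satC_nil] at h₁
      change f (atomPt 0 (pt (ex (atom 3 0 1 2)) [(mk x).out, (mk y).out]) z 0) = true
      grind
    · refine hmk.trans ⟨fun h => hcongr (hmul _ _) (ho x) (ho y) h, fun h => ?_⟩
      have h₁ := hf _ (.mul_unique x y (pt (ex (atom 4 0 1 2)) [(mk x).out, (mk y).out]) z)
      have h₂ := hcongr (hmul _ _) (ho x) (ho y) (hrefl _)
      simp only [satC_cons, not_satC_nil] at h₁
      change f (atomPt 0 (pt (ex (atom 4 0 1 2)) [(mk x).out, (mk y).out]) z 0) = true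
      grind
    · change f (atomPt 5 (mk x).out (mk y).out 0) = true ↔ _
      have h₁ := hf _ (.irrel_le 0 k x y 0 z)
      have h₂ := hf _ (.irrel_le k 0 x y z 0)
      simp only [satC_cons, not_satC_nil] at h₁ h₂
      refine ⟨fun h => ?_, fun h => ?_⟩
      · have := hcongr h (ho x) (ho y) (hrefl 0)
        grind
      · refine hcongr (x := x) (y := y) (z := 0) ?_ (hsymm (ho x)) (hsymm (ho y)) (hrefl 0)
        grind
  have truth (a : RawFormula) (v : List ℕ) : f (pt a v) = true ↔ a.Sat (v.map mk) := by
    induction a generalizing v with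
    | atom k i j l => rw [hatom, Sat, get_map h0, get_map h0, get_map h0, key]
    | and a b iha ihb =>
      have h₁ := hf _ (.and_intro a b v)
      have h₂ := hf _ (.and_left a b v)
      have h₃ := hf _ (.and_right a b v)
      simp only [satC_cons, not_satC_nil] at h₁ h₂ h₃
      rw [Sat, ← iha, ← ihb]
      grind
    | or a b iha ihb =>
      have h₁ := hf _ (.or_elim a b v)
      have h₂ := hf _ (.or_left a b v)
      have h₃ := hf _ (.or_right a b v)
      simp only [satC_cons, not_satC_nil] at h₁ h₂ h₃
      rw [Sat, ← iha, ← ihb]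
      grind
    | neg a ih =>
      have h₁ := hf _ (.neg_intro a v)
      have h₂ := hf _ (.neg_elim a v)
      simp only [satC_cons, not_satC_nil] at h₁ h₂
      rw [Sat, ← ih]
      grind
    | ex a ih =>
      have hx (x : ℕ) : a.Sat (v.map mk ++ [mk x]) ↔ f (pt a (v ++ [x])) = true := by simp [ih]
      rw [Sat]
      refine ⟨fun h => ⟨mk _, (hx _).2 (hwit a v h)⟩, fun ⟨m, hm⟩ => ?_⟩
      rw [← hout m, hx] at hm
      have := hf _ (.ex_intro a v m.out)
      simp only [satC_cons, not_satC_nil] at this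
      grind
    | bdall i a ih =>
      have hx (x : ℕ) : a.Sat (v.map mk ++ [mk x]) ↔ f (pt a (v ++ [x])) = true := by simp [ih]
      have hle (x : ℕ) : leM (mk x) (mk (v.getD i 0)) ↔ f (atomPt 5 x (v.getD i 0) 0) = true :=
        key 5 x _ 0
      rw [Sat, get_map h0]
      refine ⟨fun h m => ?_, fun h => ?_⟩
      · rw [← hout m, hx, hle]
        have := hf _ (.bdall_elim i a v m.out)
        simp only [satC_cons, not_satC_nil] at this
        grind
      · have h₁ := hf _ (.bdall_le i a v)
        have h₂ := hf _ (.bdall_intro i a v)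
        have h₃ := h (mk (pt (bdall i a) v))
        rw [hx, hle] at h₃
        simp only [satC_cons, not_satC_nil] at h₁ h₂
        grind
  exact ⟨Quotient s, inst, ⟨mk 0⟩, fun e => truth e []⟩

end Model

/-! ### Gödel numbers of translated raw formulas -/

theorem encode_map_encode {α : Type} [Encodable α] (l : List α) :
    Encodable.encode (l.map Encodable.encode) = Encodable.encode l := by
  induction l with
  | nil => rfl
  | cons a l ih => simp [ih]

/-- The codes of the symbols of a term. -/
def termSyms {m : ℕ} (t : LA.Term (Empty ⊕ Fin m)) : List ℕ := t.listEncode.map Encodable.encode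

/-- The code of a term as a symbol of a formula. -/
def termCode (m : ℕ) (l : List ℕ) : ℕ := 2 * Nat.pair m (Encodable.encode l)

/-- The codes of the symbols of a formula. -/
def formSyms {m : ℕ} (φ : LA.BoundedFormula Empty m) : List ℕ :=
  φ.listEncode.map Encodable.encode

theorem encode_formSyms {m : ℕ} (φ : LA.BoundedFormula Empty m) :
    Encodable.encode (formSyms φ) = godel φ := encode_map_encode _

section Syms

variable {m : ℕ} (t s : LA.Term (Empty ⊕ Fin m)) (φ ψ : LA.BoundedFormula Empty m)

theorem encode_inl_term :
    (Encodable.encode (Sum.inl ⟨m, t⟩ : (Σ k, LA.Term (Empty ⊕ Fin k)) ⊕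
      ((Σ n, LA.Relations n) ⊕ ℕ))) = termCode m (termSyms t) := by
  rw [Encodable.encode_inl, Encodable.encode_sigma_val, termCode, termSyms, encode_map_encode]
  rfl

theorem termSyms_zeroT : termSyms (zeroT : LA.Term (Empty ⊕ Fin m)) = [1] := rfl

theorem termSyms_succT : termSyms (succT t) = 3 :: termSyms t := by
  simp [termSyms, succT, Term.listEncode, List.finRange_succ]
  rfl

theorem termSyms_addT : termSyms (addT t s) = 5 :: (termSyms t ++ termSyms s) := by
  simp [termSyms, addT, Term.listEncode, List.finRange_succ]
  rfl

theorem termSyms_mulT : termSyms (mulT t s) = 7 :: (termSyms t ++ termSyms s) := by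
  simp [termSyms, mulT, Term.listEncode, List.finRange_succ]
  rfl

/-- The codes of the symbols of the term for a variable. -/
def varSyms (m i : ℕ) : List ℕ := if i < m then [2 * (2 * i + 1)] else [1]

theorem termSyms_varT (i : ℕ) : termSyms (varT m i) = varSyms m i := by
  unfold varT varSyms
  split_ifs
  · simp [termSyms, Term.listEncode]
    rfl
  · rfl

theorem formSyms_equal : formSyms (t =' s) = [termCode m (termSyms t), termCode m (termSyms s)] := by
  simp only [formSyms, Term.bdEqual, listEncode, List.map_cons, List.map_nil, encode_inl_term]

theorem formSyms_leF : formSyms (leF t s) =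
    [1, 2 * (2 * m + 1) + 1, termCode m (termSyms t), termCode m (termSyms s)] := by
  simp [formSyms, leF, listEncode, List.finRange_succ, ← encode_inl_term]
  rfl

theorem formSyms_imp : formSyms (φ ⟹ ψ) = 3 :: (formSyms φ ++ formSyms ψ) := by
  simp [formSyms, listEncode]

theorem formSyms_not : formSyms (∼φ) = 3 :: (formSyms φ ++ [2 * (2 * (m + 2) + 1) + 1]) := by
  simp [formSyms, listEncode]

theorem formSyms_all (φ : LA.BoundedFormula Empty (m + 1)) :
    formSyms φ.all = 7 :: formSyms φ := by
  simp [formSyms, listEncode]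

/-- The code of the symbol `⊥` in a context of length `m`. -/
def falsumCode (m : ℕ) : ℕ := 2 * (2 * (m + 2) + 1) + 1

theorem formSyms_inf : formSyms (φ ⊓ ψ) =
    3 :: 3 :: (formSyms φ ++ 3 :: (formSyms ψ ++ [falsumCode m, falsumCode m])) := by
  change formSyms (∼(φ ⟹ ∼ψ)) = _
  simp [formSyms_not, formSyms_imp, falsumCode]

theorem formSyms_sup : formSyms (φ ⊔ ψ) =
    3 :: 3 :: (formSyms φ ++ falsumCode m :: formSyms ψ) := by
  change formSyms (∼φ ⟹ ψ) = _
  simp [formSyms_not, formSyms_imp, falsumCode]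

theorem formSyms_ex (φ : LA.BoundedFormula Empty (m + 1)) : formSyms φ.ex =
    3 :: 7 :: 3 :: (formSyms φ ++ [falsumCode (m + 1), falsumCode m]) := by
  change formSyms (∼(∼φ).all) = _
  simp [formSyms_not, formSyms_all, falsumCode]

/-- The codes of the symbols of an atom. -/
def atomSyms (k m i j l : ℕ) : List ℕ :=
  if k = 0 then [termCode m (varSyms m i), termCode m (varSyms m j)]
  else if k = 1 then [termCode m (varSyms m i), termCode m [1] ]
  else if k = 2 then [termCode m (3 :: varSyms m i), termCode m (varSyms m j)]
  else if k = 3 then [termCode m (5 :: (varSyms m i ++ varSyms m j)), termCode m (varSyms m l)]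
  else if k = 4 then [termCode m (7 :: (varSyms m i ++ varSyms m j)), termCode m (varSyms m l)]
  else [1, 2 * (2 * m + 1) + 1, termCode m (varSyms m i), termCode m (varSyms m j)]

theorem formSyms_atomF (k i j l : ℕ) : formSyms (atomF k m i j l) = atomSyms k m i j l := by
  rcases k with _ | _ | _ | _ | _ | k <;>
    simp [atomF, atomSyms, formSyms_equal, formSyms_leF, termSyms_zeroT, termSyms_succT,
      termSyms_addT, termSyms_mulT, termSyms_varT]

/-- A variable of the context of length `m + 1` with the same interpretation as the variable `i` in
the context of length `m`. -/
def liftVar (m i : ℕ) : ℕ := if i < m then i else m + 1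

theorem liftT_varT (i : ℕ) : liftT (varT m i) = varT (m + 1) (liftVar m i) := by
  unfold varT liftVar
  split_ifs <;> first | omega | skip
  · rfl
  · exact congrArg (Term.func (L := LA) ArithFunc.zero) (funext fun i => i.elim0)

theorem formSyms_bound (i : ℕ) : formSyms (leF (&(Fin.last m)) (liftT (varT m i))) =
    atomSyms 5 (m + 1) m (liftVar m i) 0 := by
  rw [← formSyms_atomF, liftT_varT]
  have : (&(Fin.last m) : LA.Term (Empty ⊕ Fin (m + 1))) = varT (m + 1) m := by
    simp [varT]
    rfl
  rw [this]
  rfl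

end Syms

/-- The tokens of the translation of a raw formula. A token consists of a relative depth and of four
numbers `k`, `i`, `j`, `l`; it stands for a single logical symbol if `k < 3`, for the bound of a
quantifier if `k = 3`, and for an atom otherwise. -/
def tokens : RawFormula → List (ℕ × ℕ × ℕ × ℕ × ℕ)
  | .atom k i j l => [(0, k + 4, i, j, l)]
  | .and a b => (0, 0, 0, 0, 0) :: (0, 0, 0, 0, 0) ::
      (tokens a ++ (0, 0, 0, 0, 0) :: (tokens b ++ [(0, 2, 0, 0, 0), (0, 2, 0, 0, 0)]))
  | .or a b => (0, 0, 0, 0, 0) :: (0, 0, 0, 0, 0) ::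
      (tokens a ++ (0, 2, 0, 0, 0) :: tokens b)
  | .neg a => (0, 0, 0, 0, 0) :: (tokens a ++ [(0, 2, 0, 0, 0)])
  | .ex a => (0, 0, 0, 0, 0) :: (0, 1, 0, 0, 0) :: (0, 0, 0, 0, 0) ::
      ((tokens a).map (Prod.map (· + 1) id) ++ [(1, 2, 0, 0, 0), (0, 2, 0, 0, 0)])
  | .bdall i a => (0, 1, 0, 0, 0) :: (0, 0, 0, 0, 0) :: (0, 3, i, 0, 0) ::
      (tokens a).map (Prod.map (· + 1) id)

/-- The codes of the symbols for which a token stands. -/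
def tokenSyms (m : ℕ) (t : ℕ × ℕ × ℕ × ℕ × ℕ) : List ℕ :=
  if t.2.1 = 0 then [3]
  else if t.2.1 = 1 then [7]
  else if t.2.1 = 2 then [falsumCode (m + t.1)]
  else if t.2.1 = 3 then atomSyms 5 (m + t.1 + 1) (m + t.1) (liftVar (m + t.1) t.2.2.1) 0
  else atomSyms (t.2.1 - 4) (m + t.1) t.2.2.1 t.2.2.2.1 t.2.2.2.2

theorem flatMap_tokenSyms_shift (m : ℕ) (l : List (ℕ × ℕ × ℕ × ℕ × ℕ)) :
    (l.map (Prod.map (· + 1) id)).flatMap (tokenSyms m) = l.flatMap (tokenSyms (m + 1)) := by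
  rw [List.flatMap_map]
  congr 1
  funext t
  simp [tokenSyms, Nat.add_assoc, Nat.add_comm 1]

theorem formSyms_toF (a : RawFormula) (m : ℕ) :
    formSyms (a.toF m) = (tokens a).flatMap (tokenSyms m) := by
  induction a generalizing m with
  | atom k i j l => simp [tokens, tokenSyms, toF, formSyms_atomF]
  | and a b iha ihb => simp [tokens, toF, formSyms_inf, iha, ihb, tokenSyms]
  | or a b iha ihb => simp [tokens, toF, formSyms_sup, iha, ihb, tokenSyms]
  | neg a ih => simp [tokens, toF, formSyms_not, ih, tokenSyms, falsumCode]
  | ex a ih =>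
    simp only [tokens, toF, formSyms_ex, ih, List.flatMap_cons, List.flatMap_append,
      flatMap_tokenSyms_shift, List.flatMap_nil]
    simp [tokenSyms]
  | bdall i a ih =>
    simp only [tokens, toF, formSyms_all, formSyms_imp, formSyms_bound, ih, List.flatMap_cons,
      flatMap_tokenSyms_shift]
    simp [tokenSyms]

section Primrec

variable {α : Type} [Primcodable α] {k m i j l : α → ℕ}

@[fun_prop]
theorem primrec_varSyms (hm : Primrec m) (hi : Primrec i) :
    Primrec fun a => varSyms (m a) (i a) :=
  Primrec.ite (Primrec.nat_lt.comp hi hm) (by fun_prop) (by fun_prop)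

@[fun_prop]
theorem primrec_liftVar (hm : Primrec m) (hi : Primrec i) :
    Primrec fun a => liftVar (m a) (i a) :=
  Primrec.ite (Primrec.nat_lt.comp hi hm) (by fun_prop) (by fun_prop)

@[fun_prop]
theorem primrec_termCode {f : α → List ℕ} (hm : Primrec m) (hf : Primrec f) :
    Primrec fun a => termCode (m a) (f a) := by
  unfold termCode
  fun_prop

@[fun_prop]
theorem primrec_falsumCode (hm : Primrec m) : Primrec fun a => falsumCode (m a) := by
  unfold falsumCode
  fun_prop

@[fun_prop]
theorem primrec_atomSyms (hk : Primrec k) (hm : Primrec m) (hi : Primrec i) (hj : Primrec j)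
    (hl : Primrec l) : Primrec fun a => atomSyms (k a) (m a) (i a) (j a) (l a) := by
  have h (c : ℕ) : PrimrecPred fun a => k a = c := primrecPred_eq hk (.const c)
  unfold atomSyms
  refine .ite (h 0) ?_ (.ite (h 1) ?_ (.ite (h 2) ?_ (.ite (h 3) ?_ (.ite (h 4) ?_ ?_)))) <;>
    fun_prop

theorem primrec_tokenSyms : Primrec (tokenSyms 0) := by
  have h (c : ℕ) : PrimrecPred fun t : ℕ × ℕ × ℕ × ℕ × ℕ => t.2.1 = c :=
    primrecPred_eq (by fun_prop) (.const c)
  have hsub : Primrec fun t : ℕ × ℕ × ℕ × ℕ × ℕ => t.2.1 - 4 :=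
    Primrec.nat_sub.comp (by fun_prop) (.const 4)
  unfold tokenSyms
  refine .ite (h 0) ?_ (.ite (h 1) ?_ (.ite (h 2) ?_ (.ite (h 3) ?_ ?_))) <;> fun_prop

theorem primrec_tokens : Primrec tokens := by
  have hshift {α : Type} [Primcodable α] {f : α → List (ℕ × ℕ × ℕ × ℕ × ℕ)} (hf : Primrec f) :
      Primrec fun a => (f a).map (Prod.map (· + 1) id) :=
    Primrec.list_map hf (Primrec.to₂ (f := fun q : α × ℕ × ℕ × ℕ × ℕ × ℕ =>
      (q.2.1 + 1, q.2.2)) (by fun_prop))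
  refine primrec_of_rec tokens (f₀ := fun q => [(0, q.1 + 4, q.2.1, q.2.2.1, q.2.2.2)])
    (f₁ := fun q => (0, 0, 0, 0, 0) :: (0, 0, 0, 0, 0) ::
      (q.1 ++ (0, 0, 0, 0, 0) :: (q.2 ++ [(0, 2, 0, 0, 0), (0, 2, 0, 0, 0)])))
    (f₂ := fun q => (0, 0, 0, 0, 0) :: (0, 0, 0, 0, 0) :: (q.1 ++ (0, 2, 0, 0, 0) :: q.2))
    (f₃ := fun q => (0, 0, 0, 0, 0) :: (q ++ [(0, 2, 0, 0, 0)]))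
    (f₄ := fun q => (0, 0, 0, 0, 0) :: (0, 1, 0, 0, 0) :: (0, 0, 0, 0, 0) ::
      (q.map (Prod.map (· + 1) id) ++ [(1, 2, 0, 0, 0), (0, 2, 0, 0, 0)]))
    (f₅ := fun q => (0, 1, 0, 0, 0) :: (0, 0, 0, 0, 0) :: (0, 3, q.1, 0, 0) ::
      q.2.map (Prod.map (· + 1) id)) (by fun_prop) (by fun_prop) (by fun_prop) (by fun_prop)
    ?_ ?_ (fun _ _ _ _ => rfl) (fun _ _ => rfl) (fun _ _ => rfl) (fun _ => rfl) (fun _ => rfl)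
    (fun _ _ => rfl)
  · have := hshift (α := List (ℕ × ℕ × ℕ × ℕ × ℕ)) (f := fun q => q) (by fun_prop)
    fun_prop
  · have := hshift (α := ℕ × List (ℕ × ℕ × ℕ × ℕ × ℕ)) (f := fun q => q.2) (by fun_prop)
    fun_prop

end Primrec

/-- The Gödel number of the sentence corresponding to a raw formula is computed by a primitive
recursive function. -/
theorem primrec_godel_toF : Primrec fun a : RawFormula => godel (a.toF 0) := by
  have h : Primrec fun a : RawFormula => (tokens a).flatMap (tokenSyms 0) :=
    Primrec.list_flatMap primrec_tokens (primrec_tokenSyms.comp Primrec.snd).to₂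
  exact (Primrec.encode.comp h).of_eq fun a => by rw [← formSyms_toF, encode_formSyms]

/-- Adding double negations to a formula. -/
def pad (k : ℕ) (a : RawFormula) : RawFormula := neg^[2 * k] a

theorem sat_pad {M : Type} [LA.Structure M] (k : ℕ) (a : RawFormula) (v : List M) :
    (pad k a).Sat v ↔ a.Sat v := by
  induction k with
  | zero => rfl
  | succ k ih =>
    rw [← ih, pad, Nat.mul_succ, Function.iterate_succ_apply', Function.iterate_succ_apply']
    exact not_not

theorem le_godel_pad (k : ℕ) (a : RawFormula) : k ≤ godel ((pad k a).toF 0) := by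
  have h (n : ℕ) : n ≤ (formSyms ((neg^[n] a).toF 0)).length := by
    induction n with
    | zero => exact Nat.zero_le _
    | succ n ih =>
      rw [Function.iterate_succ_apply', toF, formSyms_not]
      simp only [List.length_cons]
      exact Nat.succ_le_succ (ih.trans (by simp))
  rw [← encode_formSyms]
  exact (show k ≤ 2 * k by omega).trans ((h (2 * k)).trans (Encodable.length_le_encode _))

theorem primrec_pad : Primrec fun k : ℕ => pad k (dec k.unpair.1) :=
  Primrec.nat_iterate (f := fun k : ℕ => 2 * k) (g := fun k => dec k.unpair.1)
    (h := fun _ a => neg a) (by fun_prop) (by fun_prop)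
    (Primrec.to₂ (f := fun p : ℕ × RawFormula => neg p.2) (by fun_prop))

theorem finite_qTheory : QTheory.Finite := by
  unfold QTheory
  exact Set.toFinite _

theorem nat_models_qTheory {φ : LA.Sentence} (hφ : φ ∈ QTheory) : ℕ ⊨ φ := by
  have hz : zeroM ℕ = 0 := rfl
  have hS (x : ℕ) : succM x = x + 1 := rfl
  have ha (x y : ℕ) : addM x y = x + y := rfl
  have hm (x y : ℕ) : mulM x y = x * y := rfl
  simp only [QTheory, Set.mem_insert_iff, Set.mem_singleton_iff] at hφ
  rcases hφ with rfl | rfl | rfl | rfl | rfl | rfl | rfl | rfl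
  all_goals
    simp [Sentence.Realize, Formula.Realize, alls, realize_leF, nat_relMap_le, realize_succT,
      realize_addT, realize_mulT, realize_zeroT, hz, hS, ha, hm, Fin.snoc]
  · omega
  · intros; ring
  · intros; ring
  · exact fun x y => ⟨fun h => ⟨y - x, by omega⟩, by omega⟩

theorem exists_rawSentence (φ : LA.Sentence) :
    ∃ e : RawFormula, ∀ (M : Type) [LA.Structure M], M ⊨ φ ↔ e.Sat ([] : List M) := by
  obtain ⟨n, hn⟩ := Transl.exists_level φ
  obtain ⟨e, -, he⟩ := hn.exists_sentence
  exact ⟨e, he⟩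

/-- There is a `Δ_{n+2}` truth assignment describing a model of `Q` together with all
`Πₙ`-sentences true in `ℕ`. -/
theorem exists_model_with_sig_truth (n : ℕ) :
    ∃ (M : Type) (_ : LA.Structure M), Nonempty M ∧ M ⊨ QTheory ∧ M ⊨ PiTh n ∧
      ∃ f : ℕ → Bool, (Sig (n + 2) fun p => f p = true) ∧
        ∀ e, f (pt e []) = true ↔ e.Sat ([] : List M) := by
  choose r hr using exists_rawSentence
  let L : List ℕ := finite_qTheory.toFinset.toList.map fun φ => (r φ).enc
  have hL (m : ℕ) : m ∈ L ↔ ∃ φ ∈ QTheory, (r φ).enc = m := by simp [L]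
  let Cl : List (ℕ × Bool) → Prop := fun c =>
    Henkin c ∨ ∃ m, c = [(pt (dec m) [], true)] ∧ (m ∈ L ∨ Tr (n + 1) (pt (dec m) []))
  have hCl : Sig (n + 1) Cl := by
    refine (sig_henkin n).or (Sig.exists_nat (A := fun q : List (ℕ × Bool) × ℕ =>
      q.1 = [(pt (dec q.2) [], true)] ∧ (q.2 ∈ L ∨ Tr (n + 1) (pt (dec q.2) []))) ?_)
    exact (Sig.of_primrecPred (primrecPred_eq (by fun_prop) (by fun_prop)) _).and
      ((Sig.of_primrecPred (primrecPred_mem (by fun_prop) (by fun_prop)) _).or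
        ((sig_tr (n + 1)).comp (by fun_prop)))
  obtain ⟨g, hg, hgs⟩ := exists_valuation
  obtain ⟨f, hf, hfs⟩ := exists_sig_valuation hCl ⟨g, by
    rintro c (hc | ⟨m, rfl, hm | hm⟩)
    · exact hg c hc
    · obtain ⟨φ, hφ, rfl⟩ := (hL m).1 hm
      simpa [dec_enc, hgs, ← hr] using nat_models_qTheory hφ
    · simpa [Tr, hgs] using hm.2⟩
  obtain ⟨M, hM, hne, hs⟩ := exists_model fun c hc => hf c (.inl hc)
  refine ⟨M, hM, hne, ⟨fun {φ} hφ => ?_⟩, ⟨fun {φ} hφ => ?_⟩, f, hfs, hs⟩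
  · rw [hr, ← hs]
    simpa [dec_enc] using hf _ (.inr ⟨_, rfl, .inl ((hL _).2 ⟨φ, hφ, rfl⟩)⟩)
  · obtain ⟨e, hl, he⟩ := (Transl.of_isPi hφ.1).exists_sentence
    rw [he, ← hs]
    have := hf _ (.inr ⟨e.enc, rfl, .inr (by simpa [Tr, dec_enc, hl] using (he ℕ).1 hφ.2)⟩)
    simpa [dec_enc] using this

/-- Craig's trick: a set of sentences whose members are enumerated by the complement of a `Sig`
predicate is axiomatized, up to padding, by a `Π`-definable set. -/
def craig (B : ℕ × ℕ → Prop) : LA.Theory :=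
  {φ | ∃ k : ℕ, ¬ B (pt (dec k.unpair.1) [], k.unpair.2) ∧ φ = (pad k (dec k.unpair.1)).toF 0}

theorem piDefinable_craig {n : ℕ} {B : ℕ × ℕ → Prop} (hB : Sig (n + 1) B) :
    PiDefinable (n + 1) (axiomCodes (craig B)) := by
  have hg : Primrec fun k : ℕ => godel ((pad k (dec k.unpair.1)).toF 0) :=
    primrec_godel_toF.comp primrec_pad
  refine piDefinable_of_sig_not (((Sig.of_primrecPred (primrecPred_eq
    (hg.comp Primrec.snd) Primrec.fst).not (n + 1)).or (hB.comp (f := fun q : ℕ × ℕ =>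
      (pt (dec q.2.unpair.1) [], q.2.unpair.2)) (by fun_prop))).forall_lt
        (f := fun m => m + 1) (by fun_prop) |>.of_iff fun m => ?_)
  constructor
  · intro h k _
    by_contra! hk
    exact h ⟨_, ⟨k, hk.2, rfl⟩, hk.1⟩
  · rintro h ⟨_, ⟨k, hk, rfl⟩, rfl⟩
    rcases h k (Nat.lt_succ_of_le (le_godel_pad _ _)) with h | h
    exacts [h rfl, hk h]

theorem realize_toF_pad (M : Type) [LA.Structure M] (k : ℕ) (a : RawFormula) :
    M ⊨ ((pad k a).toF 0 : LA.Sentence) ↔ a.Sat ([] : List M) := by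
  rw [← sat_pad k a]
  exact (realize_toF ..).trans (by simp)

theorem consistent_of_models {T : LA.Theory} (M : Type) [LA.Structure M] [Nonempty M]
    (h : M ⊨ T) : Consistent T := fun hT => by
  simpa using hT.realize_sentence M

/-- **Corollary 3.4(2).** There exists a complete and consistent extension `T`
of `Q` which is `Π_{n+1}`-definable and consistent with `Πₙ-Th(ℕ)`; hence
Rosser's incompleteness theorem fails for `Π_{n+1}`-definable theories. -/
theorem complete_piDefinable_extension (n : ℕ) :
    ∃ T : LA.Theory, ExtendsQ T ∧ Consistent T ∧
      (∀ φ : LA.Sentence, Proves T φ ∨ Proves T (∼φ)) ∧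
      Consistent (T ∪ PiTh n) ∧
      PiDefinable (n + 1) (axiomCodes T) := by

  obtain ⟨M, _, _, hQ, hPi, f, ⟨B, hB, hfB⟩, hs⟩ := exists_model_with_sig_truth n
  beta_reduce at hfB
  have hT : M ⊨ craig B := ⟨by
    rintro _ ⟨k, hk, rfl⟩
    rw [realize_toF_pad, ← hs, hfB]
    exact ⟨_, hk⟩⟩
  have hPr (φ : LA.Sentence) (hφ : M ⊨ φ) : Proves (craig B) φ := by
    obtain ⟨e, he⟩ := exists_rawSentence φ
    rw [he, ← hs, hfB] at hφ
    obtain ⟨y, hy⟩ := hφ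
    refine Theory.models_sentence_iff.2 fun N => ?_
    have hmem : (pad (Nat.pair e.enc y) e).toF 0 ∈ craig B :=
      ⟨Nat.pair e.enc y, by simpa [dec_enc] using hy, by simp [dec_enc]⟩
    exact (he N).2 ((realize_toF_pad N _ e).1 (N.is_model.realize_of_mem _ hmem))
  refine ⟨craig B, fun φ hφ => hPr φ (hQ.realize_of_mem φ hφ), consistent_of_models M hT,
    fun φ => ?_, consistent_of_models M (Theory.model_union_iff.2 ⟨hT, hPi⟩), piDefinable_craig hB⟩
  by_cases h : M ⊨ φ
  · exact .inl (hPr φ h)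
  · exact .inr (hPr _ ((Sentence.realize_not M).2 h))

end GRNonRE
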